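/- arXiv:2301.02570 — 4 statements merged into one kernel-verified Lean document; each statement's English description precedes it below -/
import Mathlib

section
/- Let q be an odd prime power. Then the number of Klein four-subgroups of PGL_2(q) is q(q²-1)/6. -/
/-- `PGL₂(F)`: the quotient of `GL(2,F)` by its center. -/
abbrev PGL2 (F : Type*) [Field F] :=
  Matrix.GeneralLinearGroup (Fin 2) F ⧸ Subgroup.center (Matrix.GeneralLinearGroup (Fin 2) F)

/-- `PSL₂(F)`: the image of `SL(2,F)` in `PGL₂(F)` under the natural map. -/
def PSL2 (F : Type*) [Field F] : Subgroup (PGL2 F) :=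
  ((QuotientGroup.mk' (Subgroup.center (Matrix.GeneralLinearGroup (Fin 2) F))).comp
    Matrix.SpecialLinearGroup.toGL).range

open Finset in
theorem card_filter_prod_of_const_fiber {α β : Type*} [Fintype α] [Fintype β]
    (P : α → Prop) (R : α → β → Prop) [DecidablePred P] [∀ a, DecidablePred (R a)] (n : ℕ)
    (h : ∀ a, P a → #{b | R a b} = n) :
    #{p : α × β | P p.1 ∧ R p.1 p.2} = #{a | P a} * n := by
  rw [card_filter, Fintype.sum_prod_type, card_filter, sum_mul]
  refine sum_congr rfl fun a _ => ?_
  by_cases ha : P a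
  · simp [ha, ← h a ha]
  · simp [ha]

section KleinFour

open IsKleinFour

/-- `x` and `y` generate a Klein four-group: `x`, `y` and `x * y` are involutions. -/
def IsKleinPair {G : Type*} [Group G] (x y : G) : Prop :=
  orderOf x = 2 ∧ orderOf y = 2 ∧ orderOf (x * y) = 2

theorem orderOf_eq_two_iff_mul_self {G : Type*} [Group G] {x : G} :
    orderOf x = 2 ↔ x * x = 1 ∧ x ≠ 1 := by
  rw [orderOf_eq_prime_iff, pow_two]

namespace IsKleinPair

variable {G : Type*} [Group G] {x y : G}

theorem ne (h : IsKleinPair x y) : x ≠ y := by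
  rintro rfl
  obtain ⟨h1, -, h3⟩ := h
  rw [orderOf_eq_two_iff_mul_self] at h1 h3
  exact h3.2 h1.1

theorem mul_comm (h : IsKleinPair x y) : y * x = x * y := by
  obtain ⟨h1, h2, h3⟩ := h
  rw [orderOf_eq_two_iff_mul_self] at h1 h2 h3
  have := inv_eq_of_mul_eq_one_left h3.1
  rwa [mul_inv_rev, inv_eq_of_mul_eq_one_left h1.1, inv_eq_of_mul_eq_one_left h2.1] at this

theorem eq_of_isKleinFour [IsKleinFour G] (h : IsKleinPair x y) (z : G) :
    z = 1 ∨ z = x ∨ z = y ∨ z = x * y := by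
  have hxy := h.ne
  obtain ⟨h1, h2, h3⟩ := h
  rw [orderOf_eq_two_iff_mul_self] at h1 h2 h3
  by_contra! hz
  exact hz.2.2.2 (eq_mul_of_ne_all h1.2 h2.2 hxy hz.1 hz.2.1 hz.2.2.1)

/-- The Klein four-subgroup `{1, x, y, x * y}`. -/
def toSubgroup (h : IsKleinPair x y) : Subgroup G where
  carrier := {1, x, y, x * y}
  one_mem' := by simp
  mul_mem' := by
    have hc := h.mul_comm
    obtain ⟨h1, h2, -⟩ := h
    rw [orderOf_eq_two_iff_mul_self] at h1 h2
    have hx (z : G) : x * (x * z) = z := by rw [← mul_assoc, h1.1, one_mul]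
    have hc' (z : G) : y * (x * z) = x * (y * z) := by rw [← mul_assoc, hc, mul_assoc]
    rintro a b (rfl | rfl | rfl | rfl) (rfl | rfl | rfl | rfl) <;>
      simp [mul_assoc, h1.1, h2.1, hc, hx, hc']
  inv_mem' := by
    have hc := h.mul_comm
    obtain ⟨h1, h2, -⟩ := h
    rw [orderOf_eq_two_iff_mul_self] at h1 h2
    rintro a (rfl | rfl | rfl | rfl) <;>
      simp [inv_eq_of_mul_eq_one_left h1.1, inv_eq_of_mul_eq_one_left h2.1, hc]

theorem mem_toSubgroup (h : IsKleinPair x y) {z : G} :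
    z ∈ h.toSubgroup ↔ z = 1 ∨ z = x ∨ z = y ∨ z = x * y := Iff.rfl

theorem isKleinFour_toSubgroup (h : IsKleinPair x y) : IsKleinFour h.toSubgroup := by
  have hxy := h.ne
  have hc := h.mul_comm
  obtain ⟨h1, h2, h3⟩ := id h
  rw [orderOf_eq_two_iff_mul_self] at h1 h2 h3
  have card : Nat.card h.toSubgroup = 4 := by
    change Nat.card ({1, x, y, x * y} : Set G) = 4
    classical
    have : ({1, x, y, x * y} : Set G) = (({1, x, y, x * y} : Finset G) : Set G) := by simp
    rw [this, Nat.card_eq_card_toFinset, Finset.toFinset_coe]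
    rw [Finset.card_insert_of_notMem, Finset.card_insert_of_notMem, Finset.card_pair]
    · simpa using h1.2
    · simpa using ⟨hxy, h2.2⟩
    · simpa [eq_comm] using ⟨h1.2, h2.2, h3.2⟩
  refine ⟨card, ?_⟩
  have hdvd : Monoid.exponent h.toSubgroup ∣ 2 := by
    refine Monoid.exponent_dvd_of_forall_pow_eq_one fun ⟨z, hz⟩ => Subtype.ext ?_
    rw [pow_two]
    rcases hz with rfl | rfl | rfl | rfl
    · simp
    · exact h1.1
    · exact h2.1
    · exact h3.1
  refine ((Nat.dvd_prime Nat.prime_two).1 hdvd).resolve_left fun h' => ?_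
  have := Monoid.exp_eq_one_iff.1 h'
  simp [Nat.card_unique] at card

end IsKleinPair

theorem card_isKleinPair_of_isKleinFour {V : Type*} [Group V] [IsKleinFour V] :
    Nat.card {p : V × V // IsKleinPair p.1 p.2} = 6 := by
  obtain ⟨e⟩ := nonempty_mulEquiv (G₁ := V) (G₂ := Multiplicative (ZMod 2 × ZMod 2))
  have : Nat.card {p : V × V // IsKleinPair p.1 p.2} =
      Nat.card {p : Multiplicative (ZMod 2 × ZMod 2) × Multiplicative (ZMod 2 × ZMod 2) //
        IsKleinPair p.1 p.2} :=
    Nat.card_congr <| (e.toEquiv.prodCongr e.toEquiv).subtypeEquiv fun p => by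
      simp [IsKleinPair, ← map_mul]
  rw [this]
  simp only [IsKleinPair, orderOf_eq_two_iff_mul_self]
  rw [Nat.card_eq_fintype_card]
  decide

/-- Each Klein four-subgroup is generated by exactly six ordered pairs. -/
theorem six_mul_card_klein_four_subgroups (G : Type*) [Group G] [Finite G] :
    6 * Nat.card {H : Subgroup G // Nonempty (H ≃* Multiplicative (ZMod 2 × ZMod 2))} =
      Nat.card {p : G × G // IsKleinPair p.1 p.2} := by
  let K := {H : Subgroup G // Nonempty (H ≃* Multiplicative (ZMod 2 × ZMod 2))}
  have hK (H : K) : IsKleinFour H.1 := by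
    obtain ⟨H, ⟨e⟩⟩ := H
    exact ⟨by rw [Nat.card_congr e.toEquiv, card_four],
      by rw [Monoid.exponent_eq_of_mulEquiv e, exponent_two]⟩
  let f : (Σ H : K, {p : H.1 × H.1 // IsKleinPair p.1 p.2}) →
      {p : G × G // IsKleinPair p.1 p.2} := fun s =>
    ⟨(s.2.1.1, s.2.1.2), by
      simpa only [IsKleinPair, ← Subgroup.coe_mul, Subgroup.orderOf_coe] using s.2.2⟩
  have hmem (s : Σ H : K, {p : H.1 × H.1 // IsKleinPair p.1 p.2}) (z : G) :
      z ∈ s.1.1 ↔ z = 1 ∨ z = (f s).1.1 ∨ z = (f s).1.2 ∨ z = (f s).1.1 * (f s).1.2 := by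
    constructor
    · intro hz
      have := hK s.1
      simpa [Subtype.ext_iff, f] using s.2.2.eq_of_isKleinFour ⟨z, hz⟩
    · rintro (rfl | rfl | rfl | rfl)
      · exact one_mem _
      · exact s.2.1.1.2
      · exact s.2.1.2.2
      · exact mul_mem s.2.1.1.2 s.2.1.2.2
  have hf : Function.Bijective f := by
    constructor
    · intro s t hst
      have hH : s.1 = t.1 := by
        ext z
        rw [hmem s, hmem t, hst]
      obtain ⟨H, p, hp⟩ := s
      obtain ⟨H', p', hp'⟩ := t
      obtain rfl : H = H' := hH
      obtain ⟨h1, h2⟩ := Prod.ext_iff.1 (Subtype.ext_iff.1 hst)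
      obtain rfl : p = p' := Prod.ext (Subtype.ext h1) (Subtype.ext h2)
      rfl
    · rintro ⟨⟨x, y⟩, h⟩
      have := h.isKleinFour_toSubgroup
      refine ⟨⟨⟨h.toSubgroup, nonempty_mulEquiv⟩,
        ⟨(⟨x, h.mem_toSubgroup.2 (by simp)⟩, ⟨y, h.mem_toSubgroup.2 (by simp)⟩), ?_⟩⟩, rfl⟩
      simpa only [IsKleinPair, ← Subgroup.orderOf_coe, Subgroup.coe_mul] using h
  have hcard (H : K) : Nat.card {p : H.1 × H.1 // IsKleinPair p.1 p.2} = 6 :=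
    have := hK H
    card_isKleinPair_of_isKleinFour
  have := Fintype.ofFinite K
  rw [← Nat.card_eq_of_bijective f hf, Nat.card_sigma, Finset.sum_congr rfl fun H _ => hcard H]
  rw [Finset.sum_const, smul_eq_mul, Finset.card_univ, ← Nat.card_eq_fintype_card, mul_comm]

end KleinFour

section Counting

variable {F : Type*} [Field F]

/-- The negative of the determinant of the trace-zero matrix `!![a, b; c, -a]`. -/
def negDet (v : F × F × F) : F := v.1 ^ 2 + v.2.1 * v.2.2

/-- The trace of the product of the trace-zero matrices `!![a, b; c, -a]`, `!![d, e; f, -d]`. -/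
def traceForm (v w : F × F × F) : F := 2 * v.1 * w.1 + v.2.1 * w.2.2 + v.2.2 * w.2.1

theorem traceForm_comm (v w : F × F × F) : traceForm v w = traceForm w v := by
  simp only [traceForm]; ring

variable [Fintype F] [DecidableEq F]

open Finset

theorem card_negDet_eq_zero : #{v : F × F × F | negDet v = 0} = Fintype.card F ^ 2 := by
  -- project `a ^ 2 + b * c = 0` to `(a, b)`, or to `(c, 0)` if `b = 0`
  rw [sq, ← Fintype.card_prod, ← card_univ]
  refine card_nbij' (fun v => if v.2.1 = 0 then (v.2.2, 0) else (v.1, v.2.1))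
    (fun u => if u.2 = 0 then (0, 0, u.1) else (u.1, u.2, -u.1 ^ 2 / u.2)) ?_ ?_ ?_ ?_
  · simp [Set.MapsTo]
  · rintro ⟨x, y⟩ -
    refine mem_coe.2 (mem_filter.2 ⟨mem_univ _, ?_⟩)
    by_cases hy : y = 0
    · simp [negDet, hy]
    · simp [negDet, hy]; field_simp; ring
  · rintro ⟨a, b, c⟩ h
    have h := (mem_filter.1 h).2
    by_cases hb : b = 0
    · subst hb
      have : a = 0 := by simpa [negDet] using h
      simp [this]
    · have : a ^ 2 + b * c = 0 := by simpa [negDet] using h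
      simp [hb]; field_simp; linear_combination -this
  · rintro ⟨x, y⟩ -
    by_cases hy : y = 0 <;> simp [hy]

theorem card_negDet_ne_zero :
    #{v : F × F × F | negDet v ≠ 0} + Fintype.card F ^ 2 = Fintype.card F ^ 3 := by
  rw [← card_negDet_eq_zero, add_comm, card_filter_add_card_filter_not]
  simp; ring

theorem card_traceForm_eq_zero (h2 : (2 : F) ≠ 0) {v : F × F × F} (hv : v ≠ 0) :
    #{w | traceForm v w = 0} = Fintype.card F ^ 2 := by
  obtain ⟨a, b, c⟩ := v
  rw [sq, ← Fintype.card_prod, ← card_univ]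
  by_cases ha : a = 0
  · by_cases hb : b = 0
    · have hc : c ≠ 0 := by rintro rfl; simp [ha, hb] at hv
      refine card_nbij' (fun w => (w.1, w.2.2))
        (fun u => (u.1, -(2 * a * u.1 + b * u.2) / c, u.2)) ?_ ?_ ?_ ?_
      · simp [Set.MapsTo]
      · rintro ⟨x, y⟩ -
        refine mem_coe.2 (mem_filter.2 ⟨mem_univ _, ?_⟩)
        simp [traceForm]; field_simp; ring
      · rintro ⟨d, e, f⟩ h
        have h : 2 * a * d + b * f + c * e = 0 := (mem_filter.1 h).2
        simp; field_simp; linear_combination -h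
      · rintro ⟨x, y⟩ -; rfl
    · refine card_nbij' (fun w => (w.1, w.2.1))
        (fun u => (u.1, u.2, -(2 * a * u.1 + c * u.2) / b)) ?_ ?_ ?_ ?_
      · simp [Set.MapsTo]
      · rintro ⟨x, y⟩ -
        refine mem_coe.2 (mem_filter.2 ⟨mem_univ _, ?_⟩)
        simp [traceForm]; field_simp; ring
      · rintro ⟨d, e, f⟩ h
        have h : 2 * a * d + b * f + c * e = 0 := (mem_filter.1 h).2
        simp; field_simp; linear_combination -h
      · rintro ⟨x, y⟩ -; rfl
  · refine card_nbij' (fun w => w.2) (fun u => (-(b * u.2 + c * u.1) / (2 * a), u)) ?_ ?_ ?_ ?_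
    · simp [Set.MapsTo]
    · rintro ⟨x, y⟩ -
      refine mem_coe.2 (mem_filter.2 ⟨mem_univ _, ?_⟩)
      simp [traceForm]; field_simp; ring
    · rintro ⟨d, e, f⟩ h
      have h : 2 * a * d + b * f + c * e = 0 := (mem_filter.1 h).2
      simp; field_simp; linear_combination -h
    · rintro ⟨x, y⟩ -; rfl

theorem card_fst_ne_zero :
    #{u : F × F | u.1 ≠ 0} + Fintype.card F = Fintype.card F ^ 2 := by
  have h : ({u : F × F | u.1 = 0} : Finset (F × F)) = ({0} : Finset F) ×ˢ univ := by
    ext ⟨x, y⟩; simp [eq_comm]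
  have h' : #{u : F × F | u.1 = 0} = Fintype.card F := by simp [h]
  have := card_filter_add_card_filter_not (s := (univ : Finset (F × F))) (fun u => u.1 = 0)
  rw [h', card_univ, Fintype.card_prod] at this
  rw [sq, ← this, add_comm]

/-- A tangent plane to the cone of singular matrices meets it in a line. -/
theorem card_traceForm_eq_zero_negDet_ne_zero {w : F × F × F}
    (hw : w ≠ 0) (hw0 : negDet w = 0) :
    #{v | traceForm w v = 0 ∧ negDet v ≠ 0} + Fintype.card F = Fintype.card F ^ 2 := by
  rw [← card_fst_ne_zero, Nat.add_right_cancel_iff]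
  obtain ⟨d, e, f⟩ := w
  have hd : d ^ 2 + e * f = 0 := hw0
  by_cases he : e = 0
  · subst he
    obtain rfl : d = 0 := by simpa using hd
    have hf : f ≠ 0 := by rintro rfl; simp at hw
    refine card_nbij' (fun v => (v.1, v.2.2)) (fun u => (u.1, 0, u.2)) ?_ ?_ ?_ ?_
    · rintro ⟨a, b, c⟩ h
      simp [traceForm, negDet, hf] at h ⊢
      intro ha
      simp [h.1, ha] at h
    · rintro ⟨x, y⟩ h
      simpa [traceForm, negDet] using h
    · rintro ⟨a, b, c⟩ h
      simp [traceForm, negDet, hf] at h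
      simp [h.1]
    · rintro ⟨x, y⟩ -; rfl
  · have hf : f = -d ^ 2 / e := by field_simp; linear_combination hd
    subst hf
    have key (u b : F) : negDet (u + b * d / e, b,
        -(2 * d * (u + b * d / e) + -d ^ 2 / e * b) / e) = u ^ 2 := by
      simp [negDet]; field_simp; ring
    have hc (a b c : F) (h : traceForm (d, e, -d ^ 2 / e) (a, b, c) = 0) :
        c = -(2 * d * ((a - b * d / e) + b * d / e) + -d ^ 2 / e * b) / e := by
      simp [traceForm] at h
      field_simp at h ⊢
      linear_combination h
    refine card_nbij' (fun v => (v.1 - v.2.1 * d / e, v.2.1))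
      (fun u => (u.1 + u.2 * d / e, u.2,
        -(2 * d * (u.1 + u.2 * d / e) + -d ^ 2 / e * u.2) / e)) ?_ ?_ ?_ ?_
    · rintro ⟨a, b, c⟩ h
      simp only [coe_filter, mem_univ, true_and, Set.mem_ofPred_eq] at h ⊢
      intro h0
      apply h.2
      have := key (a - b * d / e) b
      rw [← hc a b c h.1, sub_add_cancel, h0] at this
      simpa using this
    · rintro ⟨x, y⟩ h
      simp only [coe_filter, mem_univ, true_and, Set.mem_ofPred_eq] at h ⊢
      refine ⟨?_, by rw [key]; exact pow_ne_zero 2 h⟩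
      simp [traceForm]; field_simp; ring
    · rintro ⟨a, b, c⟩ h
      simp only [coe_filter, mem_univ, true_and, Set.mem_ofPred_eq] at h
      refine Prod.ext (sub_add_cancel _ _) (Prod.ext rfl (hc a b c h.1).symm)
    · rintro ⟨x, y⟩ -; simp

theorem card_traceForm_pairs (h2 : (2 : F) ≠ 0) :
    #{p : (F × F × F) × (F × F × F) |
        negDet p.1 ≠ 0 ∧ negDet p.2 ≠ 0 ∧ traceForm p.1 p.2 = 0} =
      Fintype.card F * (Fintype.card F ^ 2 - 1) * (Fintype.card F - 1) ^ 2 := by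
  set q := Fintype.card F with hq
  have hX := card_filter_prod_of_const_fiber (fun v : F × F × F => negDet v ≠ 0)
    (fun v w => traceForm v w = 0) (q ^ 2) fun v hv =>
      card_traceForm_eq_zero h2 (by rintro rfl; simp [negDet] at hv)
  have hY := card_filter_prod_of_const_fiber (fun w : F × F × F => w ≠ 0 ∧ negDet w = 0)
    (fun w v => traceForm w v = 0 ∧ negDet v ≠ 0) (q ^ 2 - q) fun w hw =>
      Nat.eq_sub_of_add_eq (card_traceForm_eq_zero_negDet_ne_zero hw.1 hw.2)
  have hZ := card_filter_prod_of_const_fiber (fun v : F × F × F => negDet v ≠ 0)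
    (fun _ w => w = (0 : F × F × F)) 1 fun v hv => by rw [filter_eq' univ (0 : F × F × F)]; simp
  have hsplit : #{p : (F × F × F) × (F × F × F) | negDet p.1 ≠ 0 ∧ traceForm p.1 p.2 = 0} =
      #{p : (F × F × F) × (F × F × F) |
        negDet p.1 ≠ 0 ∧ negDet p.2 ≠ 0 ∧ traceForm p.1 p.2 = 0} +
      (#{p : (F × F × F) × (F × F × F) | negDet p.1 ≠ 0 ∧ p.2 = 0} +
      #{p : (F × F × F) × (F × F × F) |
        (p.1 ≠ 0 ∧ negDet p.1 = 0) ∧ traceForm p.1 p.2 = 0 ∧ negDet p.2 ≠ 0}) := by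
    rw [← card_map (Equiv.prodComm (F × F × F) (F × F × F)).toEmbedding (s := filter
        (fun p => (p.1 ≠ 0 ∧ negDet p.1 = 0) ∧ traceForm p.1 p.2 = 0 ∧ negDet p.2 ≠ 0) _),
      ← card_union_of_disjoint, ← card_union_of_disjoint]
    · congr 1
      ext ⟨v, w⟩
      simp only [mem_union, mem_filter_univ, mem_map_equiv, Equiv.prodComm_symm,
        Equiv.prodComm_apply, Prod.swap_prod_mk]
      by_cases hw : w = 0
      · simp [hw, negDet, traceForm]
      · simp [hw, traceForm_comm w v]
        tauto
    · rw [disjoint_left]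
      rintro ⟨v, w⟩ h
      simp only [mem_union, mem_filter_univ, mem_map_equiv, Equiv.prodComm_symm,
        Equiv.prodComm_apply, Prod.swap_prod_mk] at h ⊢
      have hw : w ≠ 0 := by rintro rfl; simp [negDet] at h
      tauto
    · rw [disjoint_left]
      rintro ⟨v, w⟩ h
      simp only [mem_filter_univ, mem_map_equiv, Equiv.prodComm_symm,
        Equiv.prodComm_apply, Prod.swap_prod_mk] at h ⊢
      tauto
  have hN := card_negDet_ne_zero (F := F)
  have hI : #{w : F × F × F | w ≠ 0 ∧ negDet w = 0} + 1 = q ^ 2 := by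
    rw [hq, ← card_negDet_eq_zero, filter_and, filter_ne', erase_inter, univ_inter,
      card_erase_add_one]
    rw [mem_filter_univ]
    simp [negDet]
  rw [hX, hY, hZ] at hsplit
  rw [← hq] at hN
  have hq1 : 1 ≤ q := Fintype.card_pos
  have hq2 : 1 ≤ q ^ 2 := Nat.one_le_pow _ _ hq1
  have hq3 : q ≤ q ^ 2 := Nat.le_self_pow two_ne_zero q
  zify [hq1, hq2, hq3] at *
  rw [eq_sub_of_add_eq hN, eq_sub_of_add_eq hI] at hsplit
  linear_combination -hsplit

end Counting

section PGL

open Matrix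

variable {F : Type*} [Field F]

theorem mem_center_GL_two_iff (g : GL (Fin 2) F) :
    g ∈ Subgroup.center (GL (Fin 2) F) ↔ g 0 1 = 0 ∧ g 1 0 = 0 ∧ g 0 0 = g 1 1 := by
  rw [GeneralLinearGroup.mem_center_iff_val_mem_range_scalar]
  constructor
  · rintro ⟨a, ha⟩
    simp [← ha]
  · rintro ⟨h1, h2, h3⟩
    refine ⟨g 0 0, ?_⟩
    ext i j
    fin_cases i <;> fin_cases j <;> simp [h1, h2, h3]

theorem orderOf_mk_eq_two_iff (h2 : (2 : F) ≠ 0) (g : GL (Fin 2) F) :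
    orderOf (g : PGL2 F) = 2 ↔ g 0 0 + g 1 1 = 0 := by
  rw [orderOf_eq_two_iff_mul_self, ← QuotientGroup.mk_mul, Ne, QuotientGroup.eq_one_iff,
    QuotientGroup.eq_one_iff, mem_center_GL_two_iff, mem_center_GL_two_iff]
  have hdet : g 0 0 * g 1 1 - g 0 1 * g 1 0 ≠ 0 := by
    rw [← det_fin_two]; exact g.det_ne_zero
  simp only [Units.val_mul, mul_apply, Fin.sum_univ_two]
  constructor
  · rintro ⟨⟨h01, h10, hd⟩, hne⟩
    by_contra ht
    refine hne ⟨?_, ?_, ?_⟩ <;> apply mul_left_cancel₀ ht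
    · linear_combination h01
    · linear_combination h10
    · linear_combination hd
  · intro ht
    have hd : g 1 1 = - g 0 0 := by linear_combination ht
    rw [hd] at hdet ⊢
    refine ⟨⟨by ring, by ring, by ring⟩, ?_⟩
    rintro ⟨hb, hc, ha⟩
    have ha : g 0 0 = 0 := mul_left_cancel₀ h2 (by linear_combination ha)
    simp [ha, hb] at hdet

theorem isKleinPair_mk_iff (h2 : (2 : F) ≠ 0) (g h : GL (Fin 2) F) :
    IsKleinPair (g : PGL2 F) (h : PGL2 F) ↔ g 1 1 = - g 0 0 ∧ h 1 1 = - h 0 0 ∧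
      traceForm (g 0 0, g 0 1, g 1 0) (h 0 0, h 0 1, h 1 0) = 0 := by
  rw [IsKleinPair, ← QuotientGroup.mk_mul, orderOf_mk_eq_two_iff h2, orderOf_mk_eq_two_iff h2,
    orderOf_mk_eq_two_iff h2, add_comm, add_eq_zero_iff_eq_neg, add_comm,
    add_eq_zero_iff_eq_neg]
  refine and_congr_right fun hg => and_congr_right fun hh => ?_
  simp only [Units.val_mul, mul_apply, Fin.sum_univ_two, traceForm, hg, hh]
  ring_nf

/-- The pairs of matrices lifting Klein pairs are the orthogonal pairs of trace-zero matrices. -/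
noncomputable def kleinPairEquiv (h2 : (2 : F) ≠ 0) :
    {p : GL (Fin 2) F × GL (Fin 2) F // IsKleinPair (p.1 : PGL2 F) (p.2 : PGL2 F)} ≃
    {p : (F × F × F) × (F × F × F) //
      negDet p.1 ≠ 0 ∧ negDet p.2 ≠ 0 ∧ traceForm p.1 p.2 = 0} where
  toFun p := ⟨((p.1.1 0 0, p.1.1 0 1, p.1.1 1 0), (p.1.2 0 0, p.1.2 0 1, p.1.2 1 0)), by
    obtain ⟨⟨g, h⟩, hp⟩ := p
    obtain ⟨hg, hh, ht⟩ := (isKleinPair_mk_iff h2 g h).1 hp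
    have hg' := g.det_ne_zero
    have hh' := h.det_ne_zero
    rw [det_fin_two, hg] at hg'
    rw [det_fin_two, hh] at hh'
    refine ⟨fun h0 => hg' ?_, fun h0 => hh' ?_, ht⟩ <;>
    · simp only [negDet] at h0
      linear_combination -h0⟩
  invFun p := ⟨(
    GeneralLinearGroup.mkOfDetNeZero !![p.1.1.1, p.1.1.2.1; p.1.1.2.2, -p.1.1.1] (by
      have := p.2.1
      contrapose! this
      rw [det_fin_two_of] at this
      rw [negDet]
      linear_combination -this),
    GeneralLinearGroup.mkOfDetNeZero !![p.1.2.1, p.1.2.2.1; p.1.2.2.2, -p.1.2.1] (by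
      have := p.2.2.1
      contrapose! this
      rw [det_fin_two_of] at this
      rw [negDet]
      linear_combination -this)), by
    rw [isKleinPair_mk_iff h2]
    exact ⟨rfl, rfl, p.2.2.2⟩⟩
  left_inv p := by
    obtain ⟨⟨g, h⟩, hp⟩ := p
    obtain ⟨hg, hh, -⟩ := (isKleinPair_mk_iff h2 g h).1 hp
    refine Subtype.ext (Prod.ext (Units.ext ?_) (Units.ext ?_)) <;> ext i j <;>
      fin_cases i <;> fin_cases j <;> simp [GeneralLinearGroup.mkOfDetNeZero, hg, hh]
  right_inv p := rfl

theorem card_center_GL_two [Fintype F] :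
    Nat.card (Subgroup.center (GL (Fin 2) F)) = Fintype.card F - 1 := by
  have hinj : Function.Injective (GeneralLinearGroup.scalar (Fin 2) (R := F)) := fun a b h => by
    have := congrArg (fun g : GL (Fin 2) F => g 0 0) h
    exact Units.ext (by simpa using this)
  rw [GeneralLinearGroup.center_eq_range_scalar,
    ← Nat.card_congr (MonoidHom.ofInjective hinj).toEquiv, Nat.card_units,
    Nat.card_eq_fintype_card]

end PGL

theorem card_quotient_pairs {G : Type*} [Group G] (N : Subgroup G) (P : G ⧸ N → G ⧸ N → Prop) :
    Nat.card {p : G × G // P p.1 p.2} =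
      Nat.card {p : (G ⧸ N) × (G ⧸ N) // P p.1 p.2} * Nat.card N ^ 2 := by
  have e (x : G ⧸ N) : {g : G // (g : G ⧸ N) = x} ≃ N :=
    (QuotientGroup.preimageMkEquivSubgroupProdSet N {x}).trans (Equiv.prodUnique _ _)
  let f (p : {p : G × G // P p.1 p.2}) : {p : (G ⧸ N) × (G ⧸ N) // P p.1 p.2} :=
    ⟨(p.1.1, p.1.2), p.2⟩
  have e' (y : {p : (G ⧸ N) × (G ⧸ N) // P p.1 p.2}) : {p // f p = y} ≃ N × N :=
    { toFun p := (e y.1.1 ⟨p.1.1.1, congrArg (fun z => z.1.1) p.2⟩,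
        e y.1.2 ⟨p.1.1.2, congrArg (fun z => z.1.2) p.2⟩)
      invFun n := ⟨⟨((e y.1.1).symm n.1, (e y.1.2).symm n.2), by
          rw [((e y.1.1).symm n.1).2, ((e y.1.2).symm n.2).2]; exact y.2⟩,
        Subtype.ext (Prod.ext ((e y.1.1).symm n.1).2 ((e y.1.2).symm n.2).2)⟩
      left_inv p := by simp
      right_inv n := by simp }
  rw [Nat.card_congr ((Equiv.sigmaFiberEquiv f).symm.trans
    ((Equiv.sigmaCongrRight e').trans (Equiv.sigmaEquivProd _ _))), Nat.card_prod, Nat.card_prod,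
    sq]

/-- For an odd prime power `q`, the number of Klein four-subgroups of `PGL₂(q)`
is `q(q²-1)/6`. -/
theorem card_klein_four_PGL2 (q : ℕ) (hq : IsPrimePow q) (hodd : Odd q)
    (F : Type*) [Field F] [Fintype F] (hF : Fintype.card F = q) :
    6 * Nat.card {H : Subgroup (PGL2 F) //
        Nonempty (H ≃* Multiplicative (ZMod 2 × ZMod 2))} = q * (q ^ 2 - 1) := by
  classical
  have h2 : (2 : F) ≠ 0 := by
    refine Ring.two_ne_zero fun h => ?_
    rw [FiniteField.even_card_iff_char_two, hF] at h
    exact absurd (Nat.odd_iff.1 hodd) (by omega)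
  have hpairs := card_quotient_pairs (Subgroup.center (Matrix.GeneralLinearGroup (Fin 2) F))
    IsKleinPair
  rw [Nat.card_congr (kleinPairEquiv h2), Nat.card_eq_fintype_card, Fintype.card_subtype,
    card_traceForm_pairs h2, card_center_GL_two, hF] at hpairs
  rw [six_mul_card_klein_four_subgroups]
  have hq1 : 0 < q - 1 := Nat.sub_pos_of_lt hq.one_lt
  exact (Nat.eq_of_mul_eq_mul_right (pow_pos hq1 2) hpairs).symm
end

section
/- Let n be an odd positive integer, q an odd prime power, F a finite field with q elements, and v a nonzero vector of F^n. Let P be the stabilizer in SL(n,F) of the line F·v, i.e., the subgroup of those g ∈ SL(n,F) with g·v a scalar multiple of v. Then the index of P in SL(n,F) equals (q^n - 1)/(q - 1) = q^{n-1} + q^{n-2} + ... + q + 1; in particular this index is odd, and hence P contains a Sylow 2-subgroup of SL(n,F). -/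
/-- A subgroup whose index is prime to `p` contains a Sylow `p`-subgroup. -/
theorem Subgroup.exists_sylow_le_of_not_dvd_index {G : Type*} [Group G] [Finite G] {p : ℕ}
    [Fact p.Prime] {H : Subgroup G} (h : ¬ p ∣ H.index) :
    ∃ S : Sylow p G, (S : Subgroup G) ≤ H := by
  obtain ⟨T⟩ : Nonempty (Sylow p H) := inferInstance
  have hT : ¬ p ∣ ((T : Subgroup H).map H.subtype).index := by
    rw [Subgroup.index_map_subtype]
    exact Nat.Prime.not_dvd_mul Fact.out T.not_dvd_index h
  exact ⟨(T.2.map H.subtype).toSylow hT, Subgroup.map_subtype_le _⟩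

/-- The stabilizer in `SL(n,F)` of a line has index the number of points of projective space. -/
theorem Matrix.SpecialLinearGroup.index_stabilizer_mk {n : ℕ} {F : Type*} [Field F] [Finite F]
    {v : Fin n → F} (hv : v ≠ 0) :
    (MulAction.stabilizer (Matrix.SpecialLinearGroup (Fin n) F)
      (Projectivization.mk F v hv)).index = ∑ i ∈ Finset.range n, Nat.card F ^ i := by
  rw [MulAction.index_stabilizer_of_transitive,
    Projectivization.card_of_finrank F (Fin n → F) (Module.finrank_fin_fun F)]

/-- An element of `SL(n,F)` stabilizes the line of `v` iff it maps `v` to a multiple of `v`. -/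
theorem Matrix.SpecialLinearGroup.mem_stabilizer_mk_iff {n : ℕ} {F : Type*} [Field F]
    {v : Fin n → F} (hv : v ≠ 0) (g : Matrix.SpecialLinearGroup (Fin n) F) :
    g ∈ MulAction.stabilizer (Matrix.SpecialLinearGroup (Fin n) F) (Projectivization.mk F v hv) ↔
      ∃ c : F, Matrix.mulVec (g : Matrix (Fin n) (Fin n) F) v = c • v := by
  rw [MulAction.mem_stabilizer_iff, Projectivization.smul_mk, Projectivization.mk_eq_mk_iff']
  exact exists_congr fun _ ↦ eq_comm

/-- Let `n` be an odd positive integer, `F` a finite field of odd order `q`, `v ≠ 0` a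
vector of `F^n`, and `P` the stabilizer in `SL(n,F)` of the line `F·v` (the subgroup of
those `g` with `g·v` a scalar multiple of `v`). Then `|SL(n,F) : P| = (qⁿ-1)/(q-1)
= q^{n-1} + ⋯ + q + 1`; in particular this index is odd, and `P` contains a Sylow
`2`-subgroup of `SL(n,F)`. -/
theorem index_line_stabilizer_SL (n : ℕ) (hn : Odd n) (hn0 : 0 < n)
    (q : ℕ) (hq : IsPrimePow q) (hodd : Odd q)
    (F : Type*) [Field F] [Fintype F] (hF : Fintype.card F = q)
    (v : Fin n → F) (hv : v ≠ 0)
    (P : Subgroup (Matrix.SpecialLinearGroup (Fin n) F))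
    (hP : ∀ g : Matrix.SpecialLinearGroup (Fin n) F,
      g ∈ P ↔ ∃ c : F, Matrix.mulVec (g : Matrix (Fin n) (Fin n) F) v = c • v) :
    P.index * (q - 1) = q ^ n - 1 ∧
    P.index = ∑ i ∈ Finset.range n, q ^ i ∧
    Odd P.index ∧
    ∃ S : Sylow 2 (Matrix.SpecialLinearGroup (Fin n) F), (S : Subgroup _) ≤ P := by
  have hP' : P = MulAction.stabilizer _ (Projectivization.mk F v hv) := by
    ext g
    rw [hP, Matrix.SpecialLinearGroup.mem_stabilizer_mk_iff]
  have hidx : P.index = ∑ i ∈ Finset.range n, q ^ i := by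
    rw [hP', Matrix.SpecialLinearGroup.index_stabilizer_mk, Nat.card_eq_fintype_card, hF]
  have hP_odd : Odd P.index := by
    rw [hidx, Finset.odd_sum_iff_odd_card_odd]
    simpa [Finset.filter_true_of_mem, hodd.pow] using hn
  refine ⟨?_, hidx, hP_odd, Subgroup.exists_sylow_le_of_not_dvd_index hP_odd.not_two_dvd_nat⟩
  have hq_pos := hq.one_lt.le
  rw [hidx]
  zify [hq_pos, Nat.one_le_pow n q hq_pos]
  exact geom_sum_mul _ n
end

section
/- Let q be an odd prime power and let ε ∈ {1,-1} be such that q ≡ ε (mod 4). Then the reduced Euler characteristic of A_2(PSL_2(q)) satisfies 12·χ̃(A_2(PSL_2(q))) = -(q-ε)(q² - (6-ε)q - 12ε). -/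
/-- A subgroup is an elementary abelian `p`-subgroup if it is isomorphic to `(ℤ/pℤ)^n`
for some `n ≥ 0`. -/
def IsElementaryAbelian (p : ℕ) {G : Type*} [Group G] (H : Subgroup G) : Prop :=
  ∃ n : ℕ, Nonempty (H ≃* Multiplicative (Fin n → ZMod p))

/-- The number of chains `E₀ < E₁ < ⋯ < E_k` of length `k` of nontrivial elementary abelian
`p`-subgroups of `G`, i.e. of strictly increasing `(k+1)`-tuples in `A_p(G)`. -/
noncomputable def apChainCount (p : ℕ) (G : Type*) [Group G] (k : ℕ) : ℕ :=
  Nat.card {c : Fin (k + 1) → Subgroup G //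
    StrictMono c ∧ ∀ i, IsElementaryAbelian p (c i) ∧ c i ≠ ⊥}

/-- The reduced Euler characteristic of the poset `A_p(G)`:
`χ̃(A_p(G)) = -1 + ∑_{k ≥ 0} (-1)^k c_k` where `c_k` is the number of chains of length `k`. -/
noncomputable def reducedEulerChar (p : ℕ) (G : Type*) [Group G] : ℤ :=
  -1 + ∑ᶠ k : ℕ, (-1 : ℤ) ^ k * (apChainCount p G k : ℤ)

section ElementaryAbelian

variable {G : Type*} [Group G]

theorem isElementaryAbelian_two_iff [Finite G] (H : Subgroup G) :
    IsElementaryAbelian 2 H ↔ ∀ x ∈ H, x * x = 1 := by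
  constructor
  · rintro ⟨n, ⟨e⟩⟩ x hx
    have h : (⟨x, hx⟩ : H) * ⟨x, hx⟩ = 1 := by
      apply e.injective
      rw [map_mul, map_one]
      apply Multiplicative.toAdd.injective
      funext i
      simpa using CharTwo.add_self_eq_zero ((e ⟨x, hx⟩).toAdd i)
    simpa using congrArg Subtype.val h
  · intro h
    have hH : ∀ a : H, a * a = 1 := fun a => Subtype.ext (h a a.2)
    have hinv : ∀ a : H, a⁻¹ = a := fun a => inv_eq_of_mul_eq_one_left (hH a)
    let _ : CommGroup H :=
      { (inferInstance : Group H) with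
        mul_comm := fun a b => by rw [← hinv (a * b), mul_inv_rev, hinv, hinv] }
    let _ : Module (ZMod 2) (Additive H) :=
      AddCommGroup.zmodModule (n := 2) fun x => by
        rw [two_nsmul]; exact congrArg Additive.ofMul (hH x.toMul)
    let b := Module.finBasis (ZMod 2) (Additive H)
    exact ⟨_, ⟨AddEquiv.toMultiplicativeRight b.equivFun.toAddEquiv⟩⟩

/-- The subgroup `{1, x, y, xy}` generated by two commuting involutions. -/
def kleinSubgroup {x y : G} (hx : x * x = 1) (hy : y * y = 1) (hxy : x * y = y * x) :
    Subgroup G where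
  carrier := {1, x, y, x * y}
  one_mem' := by simp
  mul_mem' := by
    have h1 : x * (x * y) = y := by rw [← mul_assoc, hx, one_mul]
    have h2 : y * (x * y) = x := by rw [hxy, ← mul_assoc, hy, one_mul]
    have h3 : x * y * x = y := by rw [hxy, mul_assoc, hx, mul_one]
    have h4 : x * y * y = x := by rw [mul_assoc, hy, mul_one]
    have h5 : x * y * (x * y) = 1 := by rw [← mul_assoc, h3, hy]
    simp only [Set.mem_insert_iff, Set.mem_singleton_iff]
    rintro a b (rfl | rfl | rfl | rfl) (rfl | rfl | rfl | rfl) <;>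
      simp [hx, hy, h1, h2, h3, h4, h5, ← hxy]
  inv_mem' := by
    have h1 : x⁻¹ = x := inv_eq_of_mul_eq_one_left hx
    have h2 : y⁻¹ = y := inv_eq_of_mul_eq_one_left hy
    simp only [Set.mem_insert_iff, Set.mem_singleton_iff]
    rintro a (rfl | rfl | rfl | rfl) <;> simp [h1, h2, ← hxy]

theorem natCard_kleinSubgroup {x y : G} (hx : x * x = 1) (hy : y * y = 1) (hxy : x * y = y * x)
    (hx1 : x ≠ 1) (hy1 : y ≠ 1) (hne : x ≠ y) : Nat.card (kleinSubgroup hx hy hxy) = 4 := by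
  classical
  have hc : ((kleinSubgroup hx hy hxy : Subgroup G) : Set G) =
      (({1, x, y, x * y} : Finset G) : Set G) := by simp [kleinSubgroup]
  have h : x * y ≠ 1 := fun h => hne (by rw [← mul_left_inj y, h, hy])
  rw [← SetLike.coe_sort_coe, hc, Nat.card_coe_set_eq, Set.ncard_coe_finset]
  rw [Finset.card_insert_of_notMem, Finset.card_insert_of_notMem, Finset.card_insert_of_notMem,
    Finset.card_singleton] <;> simp [hx1, hy1, hne, hx1.symm, hy1.symm, h.symm]

theorem mem_kleinSubgroup {x y z : G} (hx : x * x = 1) (hy : y * y = 1) (hxy : x * y = y * x) :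
    z ∈ kleinSubgroup hx hy hxy ↔ z = 1 ∨ z = x ∨ z = y ∨ z = x * y := by
  rfl

theorem commute_of_mul_self {H : Subgroup G} (hH : ∀ x ∈ H, x * x = 1) {x y : G}
    (hx : x ∈ H) (hy : y ∈ H) : x * y = y * x := by
  have h1 : x⁻¹ = x := inv_eq_of_mul_eq_one_left (hH x hx)
  have h2 : y⁻¹ = y := inv_eq_of_mul_eq_one_left (hH y hy)
  rw [← inv_eq_of_mul_eq_one_left (hH _ (H.mul_mem hx hy)), mul_inv_rev, h1, h2]

/-- The involutions of a finite group. -/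
noncomputable def involutions (G : Type*) [Group G] [Fintype G] : Finset G := by
  classical exact {x | x ≠ 1 ∧ x * x = 1}

/-- The ordered pairs of distinct commuting involutions of a finite group. -/
noncomputable def commutingInvolutions (G : Type*) [Group G] [Fintype G] : Finset (G × G) := by
  classical exact {p | p.1 ∈ involutions G ∧ p.2 ∈ involutions G ∧ p.1 ≠ p.2 ∧ Commute p.1 p.2}

/-- The elementary abelian `2`-subgroups of a given order. -/
noncomputable def elementaryAbelianOfCard (G : Type*) [Group G] [Fintype G] (n : ℕ) :
    Finset (Subgroup G) := by
  classical exact {H | IsElementaryAbelian 2 H ∧ Nat.card H = n}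

variable [Fintype G]

theorem mem_involutions {x : G} : x ∈ involutions G ↔ x ≠ 1 ∧ x * x = 1 := by
  simp [involutions]

theorem mem_commutingInvolutions {p : G × G} : p ∈ commutingInvolutions G ↔
    p.1 ∈ involutions G ∧ p.2 ∈ involutions G ∧ p.1 ≠ p.2 ∧ Commute p.1 p.2 := by
  simp [commutingInvolutions]

theorem mem_elementaryAbelianOfCard {n : ℕ} {H : Subgroup G} :
    H ∈ elementaryAbelianOfCard G n ↔ (∀ x ∈ H, x * x = 1) ∧ Nat.card H = n := by
  simp [elementaryAbelianOfCard, isElementaryAbelian_two_iff]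

theorem natCard_zpowers_of_mem_involutions {x : G} (hx : x ∈ involutions G) :
    Nat.card (Subgroup.zpowers x) = 2 := by
  rw [mem_involutions] at hx
  rw [Nat.card_zpowers]
  exact orderOf_eq_prime (by rw [pow_two, hx.2]) hx.1

theorem mem_zpowers_involution {x y : G} (hx : x ∈ involutions G)
    (hy : y ∈ Subgroup.zpowers x) : y = 1 ∨ y = x := by
  rw [mem_involutions] at hx
  obtain ⟨k, rfl⟩ := Subgroup.mem_zpowers_iff.1 hy
  rcases Int.even_or_odd' k with ⟨m, rfl | rfl⟩
  · left; rw [zpow_mul, zpow_ofNat, pow_two, hx.2, one_zpow]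
  · right; rw [zpow_add, zpow_mul, zpow_ofNat, pow_two, hx.2, one_zpow, one_mul, zpow_one]

theorem zpowers_mem_elementaryAbelianOfCard {x : G} (hx : x ∈ involutions G) :
    Subgroup.zpowers x ∈ elementaryAbelianOfCard G 2 := by
  refine mem_elementaryAbelianOfCard.2 ⟨fun y hy => ?_, natCard_zpowers_of_mem_involutions hx⟩
  rcases mem_zpowers_involution hx hy with rfl | rfl
  · simp
  · exact (mem_involutions.1 hx).2

theorem zpowers_injOn_involutions {x y : G} (hx : x ∈ involutions G) (hy : y ∈ involutions G)
    (h : Subgroup.zpowers x = Subgroup.zpowers y) : x = y := by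
  have h1 : x ∈ Subgroup.zpowers y := h ▸ Subgroup.mem_zpowers x
  exact (mem_zpowers_involution hy h1).resolve_left (mem_involutions.1 hx).1

theorem exists_zpowers_eq {E : Subgroup G} (hE : E ∈ elementaryAbelianOfCard G 2) :
    ∃ x ∈ involutions G, Subgroup.zpowers x = E := by
  rw [mem_elementaryAbelianOfCard] at hE
  have hne : E ≠ ⊥ := by rintro rfl; simp at hE
  obtain ⟨⟨x, hx⟩, hx1⟩ := Subgroup.ne_bot_iff_exists_ne_one.1 hne
  replace hx1 : x ≠ 1 := by simpa using hx1
  have hxi : (x : G) ∈ involutions G := mem_involutions.2 ⟨hx1, hE.1 x hx⟩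
  refine ⟨x, hxi, Subgroup.eq_of_le_of_card_ge (by simpa using hx) ?_⟩
  rw [natCard_zpowers_of_mem_involutions hxi, hE.2]

theorem kleinSubgroup_mem_elementaryAbelianOfCard {x y : G} (hx : x * x = 1) (hy : y * y = 1)
    (hxy : x * y = y * x) (hx1 : x ≠ 1) (hy1 : y ≠ 1) (hne : x ≠ y) :
    kleinSubgroup hx hy hxy ∈ elementaryAbelianOfCard G 4 := by
  refine mem_elementaryAbelianOfCard.2 ⟨fun z hz => ?_,
    natCard_kleinSubgroup hx hy hxy hx1 hy1 hne⟩
  have h3 : x * y * x = y := by rw [hxy, mul_assoc, hx, mul_one]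
  have h5 : x * y * (x * y) = 1 := by rw [← mul_assoc, h3, hy]
  rcases (mem_kleinSubgroup hx hy hxy).1 hz with rfl | rfl | rfl | rfl <;>
    simp [hx, hy, h5]

theorem card_elementaryAbelianOfCard_two :
    (elementaryAbelianOfCard G 2).card = (involutions G).card := by
  symm
  exact Finset.card_bij (fun x _ => Subgroup.zpowers x)
    (fun x hx => zpowers_mem_elementaryAbelianOfCard hx)
    (fun x hx y hy h => zpowers_injOn_involutions hx hy h)
    (fun E hE => by simpa using exists_zpowers_eq hE)

theorem card_involutions_mem [DecidableEq G] {H : Subgroup G} [DecidablePred (· ∈ H)]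
    (hH : H ∈ elementaryAbelianOfCard G 4) :
    ((involutions G).filter (· ∈ H)).card = 3 := by
  rw [mem_elementaryAbelianOfCard] at hH
  have h : (involutions G).filter (· ∈ H) = (Finset.univ.filter (· ∈ H)).erase 1 := by
    ext x
    simp only [Finset.mem_filter, mem_involutions, Finset.mem_erase, Finset.mem_univ, true_and]
    exact ⟨fun h => ⟨h.1.1, h.2⟩, fun h => ⟨⟨h.1, hH.1 x h.2⟩, h.2⟩⟩
  rw [h, Finset.card_erase_of_mem (by simp [H.one_mem]), ← Fintype.card_subtype,
    ← Nat.card_eq_fintype_card]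
  have := hH.2
  change Nat.card {x // x ∈ H} - 1 = 3
  rw [this]

theorem card_commutingInvolutions :
    (commutingInvolutions G).card = 6 * (elementaryAbelianOfCard G 4).card := by
  classical
  have hmaps : ∀ p ∈ commutingInvolutions G,
      Subgroup.closure {p.1, p.2} ∈ elementaryAbelianOfCard G 4 := by
    rintro ⟨x, y⟩ hp
    simp only [mem_commutingInvolutions, mem_involutions] at hp
    obtain ⟨⟨hx1, hx⟩, ⟨hy1, hy⟩, hne, hxy⟩ := hp
    have : Subgroup.closure {x, y} = kleinSubgroup hx hy hxy := by
      refine le_antisymm ?_ ?_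
      · rw [Subgroup.closure_le]
        rintro z (rfl | rfl)
        · exact Or.inr (Or.inl rfl)
        · exact Or.inr (Or.inr (Or.inl rfl))
      · have h1 : x ∈ Subgroup.closure {x, y} := Subgroup.subset_closure (by simp)
        have h2 : y ∈ Subgroup.closure {x, y} := Subgroup.subset_closure (by simp)
        intro z hz
        rcases (mem_kleinSubgroup hx hy hxy).1 hz with rfl | rfl | rfl | rfl
        exacts [one_mem _, h1, h2, mul_mem h1 h2]
    rw [this]
    exact kleinSubgroup_mem_elementaryAbelianOfCard hx hy hxy hx1 hy1 hne
  rw [Finset.card_eq_sum_card_fiberwise hmaps, Finset.sum_const_nat (m := 6), mul_comm]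
  intro H hH
  have h3 := card_involutions_mem hH
  have : (commutingInvolutions G).filter (fun p => Subgroup.closure {p.1, p.2} = H) =
      ((involutions G).filter (· ∈ H)).offDiag := by
    ext ⟨x, y⟩
    rw [Finset.mem_filter, Finset.mem_offDiag, Finset.mem_filter, Finset.mem_filter]
    constructor
    · rintro ⟨hp, rfl⟩
      have hp' := mem_commutingInvolutions.1 hp
      exact ⟨⟨hp'.1, Subgroup.subset_closure (by simp)⟩,
        ⟨hp'.2.1, Subgroup.subset_closure (by simp)⟩, hp'.2.2.1⟩
    · rintro ⟨⟨hx, hxH⟩, ⟨hy, hyH⟩, hne⟩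
      have hH' := mem_elementaryAbelianOfCard.1 hH
      have hp : (x, y) ∈ commutingInvolutions G :=
        mem_commutingInvolutions.2 ⟨hx, hy, hne, commute_of_mul_self hH'.1 hxH hyH⟩
      refine ⟨hp, Subgroup.eq_of_le_of_card_ge ?_ ?_⟩
      · rw [Subgroup.closure_le]
        rintro z (rfl | rfl) <;> assumption
      · rw [hH'.2, (mem_elementaryAbelianOfCard.1 (hmaps _ hp)).2]
  rw [this, Finset.offDiag_card, h3]

/-- Three pairwise commuting involutions never generate a group of order `8`. -/
def HasTwoRankLETwo (G : Type*) [Group G] : Prop :=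
  ∀ x y z : G, x ≠ 1 → y ≠ 1 → x ≠ y → x * x = 1 → y * y = 1 → z * z = 1 →
    x * y = y * x → x * z = z * x → y * z = z * y → z = 1 ∨ z = x ∨ z = y ∨ z = x * y

theorem isElementaryAbelian_ne_bot_iff (hG : HasTwoRankLETwo G) (H : Subgroup G) :
    IsElementaryAbelian 2 H ∧ H ≠ ⊥ ↔
      H ∈ elementaryAbelianOfCard G 2 ∨ H ∈ elementaryAbelianOfCard G 4 := by
  rw [isElementaryAbelian_two_iff, mem_elementaryAbelianOfCard, mem_elementaryAbelianOfCard]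
  constructor
  · rintro ⟨hH, hne⟩
    obtain ⟨⟨x, hx⟩, hx1⟩ := Subgroup.ne_bot_iff_exists_ne_one.1 hne
    replace hx1 : x ≠ 1 := by simpa using hx1
    have hxi : x ∈ involutions G := mem_involutions.2 ⟨hx1, hH x hx⟩
    by_cases hle : H ≤ Subgroup.zpowers x
    · have : H = Subgroup.zpowers x := le_antisymm hle (by simpa using hx)
      exact Or.inl ⟨hH, this ▸ natCard_zpowers_of_mem_involutions hxi⟩
    · obtain ⟨y, hy, hyx⟩ := Set.not_subset.1 hle
      have hy1 : y ≠ 1 := by rintro rfl; exact hyx (one_mem _)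
      have hne : x ≠ y := by rintro rfl; exact hyx (Subgroup.mem_zpowers x)
      have hxy := commute_of_mul_self hH hx hy
      have : H = kleinSubgroup (hH x hx) (hH y hy) hxy := by
        ext z
        rw [mem_kleinSubgroup]
        constructor
        · intro hz
          exact hG x y z hx1 hy1 hne (hH x hx) (hH y hy) (hH z hz) hxy
            (commute_of_mul_self hH hx hz) (commute_of_mul_self hH hy hz)
        · rintro (rfl | rfl | rfl | rfl)
          exacts [one_mem _, hx, hy, mul_mem hx hy]
      refine Or.inr ⟨hH, ?_⟩
      rw [this]
      exact natCard_kleinSubgroup _ _ _ hx1 hy1 hne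
  · rintro (⟨h1, h2⟩ | ⟨h1, h2⟩) <;> refine ⟨h1, ?_⟩ <;> rintro rfl <;> simp at h2

theorem disjoint_elementaryAbelianOfCard {m n : ℕ} (h : m ≠ n) :
    Disjoint (elementaryAbelianOfCard G m) (elementaryAbelianOfCard G n) := by
  rw [Finset.disjoint_left]
  intro E h1 h2
  rw [mem_elementaryAbelianOfCard] at h1 h2
  exact h (h1.2.symm.trans h2.2)

theorem natCard_lt_of_lt {E H : Subgroup G} (h : E < H) : Nat.card E < Nat.card H := by
  by_contra! hle
  exact h.ne (Subgroup.eq_of_le_of_card_ge h.le hle)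

theorem card_two_or_four (hG : HasTwoRankLETwo G) {H : Subgroup G}
    (hH : IsElementaryAbelian 2 H ∧ H ≠ ⊥) : Nat.card H = 2 ∨ Nat.card H = 4 :=
  ((isElementaryAbelian_ne_bot_iff hG H).1 hH).imp
    (fun h => (mem_elementaryAbelianOfCard.1 h).2) (fun h => (mem_elementaryAbelianOfCard.1 h).2)

theorem apChainCount_zero (hG : HasTwoRankLETwo G) :
    apChainCount 2 G 0 =
      (elementaryAbelianOfCard G 2).card + (elementaryAbelianOfCard G 4).card := by
  classical
  rw [← Finset.card_union_of_disjoint (disjoint_elementaryAbelianOfCard (by norm_num)),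
    ← Fintype.card_coe, ← Nat.card_eq_fintype_card]
  refine Nat.card_congr ((Equiv.funUnique (Fin 1) (Subgroup G)).subtypeEquiv fun c => ?_)
  rw [Finset.mem_union, ← isElementaryAbelian_ne_bot_iff hG]
  exact ⟨fun h => h.2 0, fun h => ⟨Subsingleton.strictMono c, fun i => by
    rwa [Fin.fin_one_eq_zero i]⟩⟩

theorem apChainCount_one (hG : HasTwoRankLETwo G) :
    apChainCount 2 G 1 = 3 * (elementaryAbelianOfCard G 4).card := by
  classical
  have h1 : apChainCount 2 G 1 = Fintype.card
      ((elementaryAbelianOfCard G 4).sigma fun H => (involutions G).filter (· ∈ H)) := by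
    rw [← Nat.card_eq_fintype_card]
    symm
    refine Nat.card_congr (Equiv.ofBijective (fun p => ⟨![Subgroup.zpowers p.1.2, p.1.1], ?_⟩) ?_)
    · obtain ⟨⟨H, x⟩, hp⟩ := p
      rw [Finset.mem_sigma, Finset.mem_filter] at hp
      obtain ⟨hH, hx, hxH⟩ := hp
      dsimp only at hH hx hxH
      have hE := zpowers_mem_elementaryAbelianOfCard hx
      refine ⟨?_, ?_⟩
      · rw [Fin.strictMono_iff_lt_succ]
        intro i
        fin_cases i
        change Subgroup.zpowers x < H
        refine lt_of_le_of_ne (by simpa using hxH) ?_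
        rintro rfl
        exact Finset.disjoint_left.1
          (disjoint_elementaryAbelianOfCard (show (2 : ℕ) ≠ 4 by norm_num)) hE hH
      · refine fun i => (isElementaryAbelian_ne_bot_iff hG _).2 ?_
        fin_cases i
        exacts [Or.inl hE, Or.inr hH]
    · constructor
      · rintro ⟨⟨H, x⟩, hp⟩ ⟨⟨K, y⟩, hq⟩ h
        rw [Finset.mem_sigma, Finset.mem_filter] at hp hq
        have h' := congrArg Subtype.val h
        have h0 := congrFun h' 0
        have h1 := congrFun h' 1
        obtain rfl : H = K := h1
        obtain rfl := zpowers_injOn_involutions hp.2.1 hq.2.1 h0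
        rfl
      · rintro ⟨c, hc, hA⟩
        have h01 : c 0 < c 1 := hc (by simp)
        have hlt := natCard_lt_of_lt h01
        have c0 := (isElementaryAbelian_ne_bot_iff hG _).1 (hA 0)
        have c1 := (isElementaryAbelian_ne_bot_iff hG _).1 (hA 1)
        have hc0 : c 0 ∈ elementaryAbelianOfCard G 2 := by
          refine c0.resolve_right fun h => ?_
          rcases c1 with h' | h' <;>
            rw [(mem_elementaryAbelianOfCard.1 h).2, (mem_elementaryAbelianOfCard.1 h').2] at hlt <;>
            omega
        have hc1 : c 1 ∈ elementaryAbelianOfCard G 4 := by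
          refine c1.resolve_left fun h' => ?_
          rw [(mem_elementaryAbelianOfCard.1 hc0).2, (mem_elementaryAbelianOfCard.1 h').2] at hlt
          omega
        obtain ⟨x, hx, hxE⟩ := exists_zpowers_eq hc0
        have hxH : x ∈ c 1 := h01.le (hxE ▸ Subgroup.mem_zpowers x)
        refine ⟨⟨⟨c 1, x⟩, by simp [hc1, hx, hxH]⟩, Subtype.ext ?_⟩
        funext i
        fin_cases i
        · exact hxE
        · rfl
  rw [h1, Fintype.card_coe, Finset.card_sigma, Finset.sum_const_nat (m := 3), mul_comm]
  intro H hH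
  exact card_involutions_mem hH

theorem apChainCount_add_two (hG : HasTwoRankLETwo G) (k : ℕ) :
    apChainCount 2 G (k + 2) = 0 := by
  have : IsEmpty {c : Fin (k + 2 + 1) → Subgroup G //
      StrictMono c ∧ ∀ i, IsElementaryAbelian 2 (c i) ∧ c i ≠ ⊥} := by
    refine ⟨fun ⟨c, hc, hA⟩ => ?_⟩
    have h01 := natCard_lt_of_lt (hc (show (⟨0, by omega⟩ : Fin (k + 2 + 1)) < ⟨1, by omega⟩ from
      Nat.zero_lt_one))
    have h12 := natCard_lt_of_lt (hc (show (⟨1, by omega⟩ : Fin (k + 2 + 1)) < ⟨2, by omega⟩ from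
      Nat.one_lt_two))
    have h0 := card_two_or_four hG (hA ⟨0, by omega⟩)
    have h1 := card_two_or_four hG (hA ⟨1, by omega⟩)
    have h2 := card_two_or_four hG (hA ⟨2, by omega⟩)
    omega
  exact Nat.card_of_isEmpty

/-- The reduced Euler characteristic of `A₂(G)` for a finite group of `2`-rank at most two. -/
theorem three_mul_reducedEulerChar_two (hG : HasTwoRankLETwo G) :
    3 * reducedEulerChar 2 G =
      -3 + 3 * ((involutions G).card : ℤ) - ((commutingInvolutions G).card : ℤ) := by
  have h : ∑ᶠ k : ℕ, (-1 : ℤ) ^ k * (apChainCount 2 G k : ℤ) =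
      ∑ k ∈ Finset.range 2, (-1 : ℤ) ^ k * (apChainCount 2 G k : ℤ) := by
    refine finsum_eq_sum_of_support_subset _ fun k hk => ?_
    by_contra hk'
    obtain ⟨m, rfl⟩ := Nat.exists_eq_add_of_le' (show 2 ≤ k by simpa [Nat.succ_le_iff] using hk')
    exact hk (by simp [apChainCount_add_two hG])
  rw [reducedEulerChar, h, Finset.sum_range_succ, Finset.sum_range_one, apChainCount_zero hG,
    apChainCount_one hG, card_elementaryAbelianOfCard_two, card_commutingInvolutions]
  push_cast
  ring

end ElementaryAbelian

section Counting

variable {F : Type*} [Field F] [Fintype F] [DecidableEq F]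

theorem card_sq_add_sq_eq (hF : ringChar F ≠ 2) {n : F} (hn : n ≠ 0) :
    (({p : F × F | p.1 ^ 2 + p.2 ^ 2 = n} : Finset (F × F)).card : ℤ) =
      Fintype.card F - quadraticChar F (-1) := by
  have hsqrt : ∀ a : F, (({x : F | x ^ 2 = a} : Finset F).card : ℤ) = quadraticChar F a + 1 := by
    intro a
    rw [← quadraticChar_card_sqrts hF a, Set.toFinset_ofPred]
  have hfib : ∀ a : F, ((({p : F × F | p.1 ^ 2 + p.2 ^ 2 = n} : Finset (F × F)).filter
      (fun p => p.1 ^ 2 = a)).card : ℤ) =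
        (quadraticChar F a + 1) * (quadraticChar F (n - a) + 1) := by
    intro a
    rw [← hsqrt, ← hsqrt, ← Nat.cast_mul, ← Finset.card_product]
    congr 2
    ext ⟨x, y⟩
    simp only [Finset.mem_filter, Finset.mem_univ, true_and, Finset.mem_product]
    constructor
    · rintro ⟨h1, h2⟩
      exact ⟨h2, by rw [← h1, ← h2]; ring⟩
    · rintro ⟨h1, h2⟩
      exact ⟨by rw [h1, h2]; ring, h1⟩
  have hJ : ∑ a : F, quadraticChar F a * quadraticChar F (n - a) = -quadraticChar F (-1) := by
    have h1 := jacobiSum_nontrivial_inv (quadraticChar_ne_one hF)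
    rw [(quadraticChar_isQuadratic F).inv, jacobiSum] at h1
    rw [← h1]
    refine Eq.symm (Fintype.sum_equiv (Equiv.mulLeft₀ n hn) _ _ fun b => ?_)
    have h2 : n - n * b = n * (1 - b) := by ring
    simp only [Equiv.mulLeft₀_apply, h2, map_mul]
    have h3 := quadraticChar_sq_one hn
    linear_combination (-(quadraticChar F b * quadraticChar F (1 - b))) * h3
  have hs : ∑ a : F, quadraticChar F (n - a) = 0 := by
    rw [← quadraticChar_sum_zero hF]
    exact Fintype.sum_equiv (Equiv.subLeft n) _ _ fun _ => rfl
  rw [Finset.card_eq_sum_card_fiberwise (f := fun p => p.1 ^ 2) (t := Finset.univ) (by simp),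
    Nat.cast_sum, Finset.sum_congr rfl fun a _ => hfib a]
  simp only [add_mul, mul_add, Finset.sum_add_distrib, one_mul, mul_one, hJ, hs,
    quadraticChar_sum_zero hF, Finset.sum_const, Finset.card_univ, nsmul_eq_mul]
  ring

theorem card_mul_eq (m : F) :
    (({p : F × F | p.1 * p.2 = m} : Finset (F × F)).card : ℤ) =
      (Fintype.card F - 1) + if m = 0 then (Fintype.card F : ℤ) else 0 := by
  have hfib : ∀ b : F, ((({p : F × F | p.1 * p.2 = m} : Finset (F × F)).filter
      (fun p => p.1 = b)).card : ℤ) =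
        1 + if b = 0 then (if m = 0 then (Fintype.card F : ℤ) else 0) - 1 else 0 := by
    intro b
    have hinj : ((({p : F × F | p.1 * p.2 = m} : Finset (F × F)).filter
        (fun p => p.1 = b)).card) = ({c : F | b * c = m} : Finset F).card := by
      refine Finset.card_nbij' Prod.snd (fun c => (b, c)) ?_ ?_ ?_ ?_
      · rintro ⟨x, y⟩ h
        simp only [Finset.coe_filter, Finset.mem_filter, Finset.mem_univ, true_and,
          Set.mem_ofPred_eq] at h ⊢
        rw [← h.2, h.1]
      · intro c h
        simpa using h
      · rintro ⟨x, y⟩ h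
        simp only [Finset.coe_filter, Finset.mem_filter, Finset.mem_univ, true_and,
          Set.mem_ofPred_eq] at h
        rw [← h.2]
      · intro c _
        rfl
    rw [hinj]
    by_cases hb : b = 0
    · subst hb
      by_cases hm : m = 0
      · simp [hm]
      · simp [hm, Ne.symm hm]
    · have : ({c : F | b * c = m} : Finset F) = {m / b} := by
        ext c
        simp only [Finset.mem_filter, Finset.mem_univ, true_and, Finset.mem_singleton]
        rw [eq_div_iff hb, mul_comm]
      simp [this, hb]
  rw [Finset.card_eq_sum_card_fiberwise (f := fun p => p.1) (t := Finset.univ) (by simp),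
    Nat.cast_sum, Finset.sum_congr rfl fun a _ => hfib a, Finset.sum_add_distrib,
    Finset.sum_ite_eq' Finset.univ (0 : F)]
  simp only [Finset.sum_const, Finset.card_univ, nsmul_eq_mul, Finset.mem_univ, if_true]
  ring

theorem card_sq_add_mul_eq_neg_one (hF : ringChar F ≠ 2) :
    (({t : F × F × F | t.1 ^ 2 + t.2.1 * t.2.2 = -1} : Finset (F × F × F)).card : ℤ) =
      Fintype.card F * (Fintype.card F + quadraticChar F (-1)) := by
  have hfib : ∀ a : F, ((({t : F × F × F | t.1 ^ 2 + t.2.1 * t.2.2 = -1} :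
      Finset (F × F × F)).filter (fun t => t.1 = a)).card : ℤ) =
        (Fintype.card F - 1) + if a ^ 2 = -1 then (Fintype.card F : ℤ) else 0 := by
    intro a
    have hinj : (({t : F × F × F | t.1 ^ 2 + t.2.1 * t.2.2 = -1} :
        Finset (F × F × F)).filter (fun t => t.1 = a)).card =
          ({p : F × F | p.1 * p.2 = -1 - a ^ 2} : Finset (F × F)).card := by
      refine Finset.card_nbij' Prod.snd (fun c => (a, c)) ?_ ?_ ?_ ?_
      · rintro ⟨x, y⟩ h
        simp only [Finset.coe_filter, Finset.mem_filter, Finset.mem_univ, true_and,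
          Set.mem_ofPred_eq] at h ⊢
        rw [← h.1, h.2]; ring
      · intro c h
        simp only [Finset.coe_filter, Finset.mem_filter, Finset.mem_univ, true_and,
          Set.mem_ofPred_eq, and_true] at h ⊢
        rw [h]; ring
      · rintro ⟨x, y⟩ h
        simp only [Finset.coe_filter, Finset.mem_filter, Finset.mem_univ, true_and,
          Set.mem_ofPred_eq] at h
        rw [← h.2]
      · intro c _
        rfl
    rw [hinj, card_mul_eq]
    simp only [sub_eq_zero, eq_comm (a := (-1 : F))]
  rw [Finset.card_eq_sum_card_fiberwise (f := fun p => p.1) (t := Finset.univ) (by simp),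
    Nat.cast_sum, Finset.sum_congr rfl fun a _ => hfib a, Finset.sum_add_distrib,
    ← Finset.sum_filter]
  have h := quadraticChar_card_sqrts hF (-1)
  rw [Set.toFinset_ofPred] at h
  simp only [Finset.sum_const, Finset.card_univ, nsmul_eq_mul, h]
  ring

theorem card_orthogonal_of_ne_zero (hF : ringChar F ≠ 2) {a b c : F} (h : a ^ 2 + b * c = -1)
    (hb : b ≠ 0) :
    (({t : F × F × F | t.1 ^ 2 + t.2.1 * t.2.2 = -1 ∧ 2 * a * t.1 + b * t.2.2 + c * t.2.1 = 0} :
      Finset (F × F × F)).card : ℤ) = Fintype.card F - quadraticChar F (-1) := by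
  rw [← card_sq_add_sq_eq hF (n := -b ^ 2) (by simpa using hb), Nat.cast_inj]
  refine Finset.card_nbij' (fun t => (b * t.1 - a * t.2.1, t.2.1))
    (fun p => ((p.1 + a * p.2) / b, p.2, -(2 * a * ((p.1 + a * p.2) / b) + c * p.2) / b))
    ?_ ?_ ?_ ?_
  · rintro ⟨x, y, z⟩ ht
    simp only [Finset.coe_filter, Finset.mem_univ, true_and, Set.mem_ofPred_eq] at ht ⊢
    linear_combination b ^ 2 * ht.1 - b * y * ht.2 + y ^ 2 * h
  · rintro ⟨u, v⟩ hp
    simp only [Finset.coe_filter, Finset.mem_univ, true_and, Set.mem_ofPred_eq] at hp ⊢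
    constructor
    · field_simp
      linear_combination hp - v ^ 2 * h
    · field_simp
      ring
  · rintro ⟨x, y, z⟩ ht
    simp only [Finset.coe_filter, Finset.mem_univ, true_and, Set.mem_ofPred_eq] at ht
    have hx : (b * x - a * y + a * y) / b = x := by field_simp; ring
    refine Prod.ext hx (Prod.ext rfl ?_)
    dsimp only
    rw [hx, div_eq_iff hb]
    linear_combination -ht.2
  · rintro ⟨u, v⟩ _
    refine Prod.ext ?_ rfl
    dsimp only
    field_simp
    ring

theorem card_orthogonal (hF : ringChar F ≠ 2) {a b c : F} (h : a ^ 2 + b * c = -1) :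
    (({t : F × F × F | t.1 ^ 2 + t.2.1 * t.2.2 = -1 ∧ 2 * a * t.1 + b * t.2.2 + c * t.2.1 = 0} :
      Finset (F × F × F)).card : ℤ) = Fintype.card F - quadraticChar F (-1) := by
  by_cases hb : b = 0
  · by_cases hc : c = 0
    · subst hb hc
      have ha : a ≠ 0 := by rintro rfl; simp at h
      have h2 : (2 : F) ≠ 0 := Ring.two_ne_zero hF
      have hχ : quadraticChar F (-1) = 1 := by
        rw [quadraticChar_one_iff_isSquare (by simp)]
        exact ⟨a, by linear_combination -h⟩
      have := card_mul_eq (-1 : F)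
      rw [if_neg (by simp), add_zero] at this
      rw [hχ, ← this, Nat.cast_inj]
      refine Finset.card_nbij' Prod.snd (fun p => (0, p)) ?_ ?_ ?_ ?_
      · rintro ⟨x, y, z⟩ ht
        simp only [Finset.coe_filter, Finset.mem_univ, true_and, Set.mem_ofPred_eq] at ht ⊢
        have hx : x = 0 := by simpa [ha, h2] using ht.2
        simpa [hx] using ht.1
      · rintro p hp
        simpa using hp
      · rintro ⟨x, y, z⟩ ht
        simp only [Finset.coe_filter, Finset.mem_univ, true_and, Set.mem_ofPred_eq] at ht
        have hx : x = 0 := by simpa [ha, h2] using ht.2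
        rw [hx]
      · intro p _
        rfl
    · rw [← card_orthogonal_of_ne_zero hF (a := a) (b := c) (c := b) (by rw [← h]; ring) hc,
        Nat.cast_inj]
      refine Finset.card_nbij' (fun t => (t.1, t.2.2, t.2.1)) (fun t => (t.1, t.2.2, t.2.1))
        ?_ ?_ (fun _ _ => rfl) (fun _ _ => rfl) <;>
      · rintro ⟨x, y, z⟩ ht
        simp only [Finset.coe_filter, Finset.mem_univ, true_and, Set.mem_ofPred_eq] at ht ⊢
        exact ⟨by rw [← ht.1]; ring, by rw [← ht.2]; ring⟩
  · exact card_orthogonal_of_ne_zero hF h hb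

end Counting

section ProjectiveSpecialLinear

open Matrix

theorem card_eq_mul_of_card_fiber_eq {α β : Type*} [DecidableEq α] [DecidableEq β] {s : Finset α}
    {t : Finset β} {f : α → β} {k : ℕ} (hst : ∀ a ∈ s, f a ∈ t)
    (hk : ∀ b ∈ t, (s.filter (f · = b)).card = k) : s.card = t.card * k := by
  rw [Finset.card_eq_sum_card_fiberwise hst, Finset.sum_const_nat hk]

/-- In any group, two elements are distinct commuting involutions iff both of them and their
product are involutions. -/
theorem mem_commutingInvolutions_iff {G : Type*} [Group G] [Fintype G] {x y : G} :
    (x, y) ∈ commutingInvolutions G ↔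
      x ∈ involutions G ∧ y ∈ involutions G ∧ x * y ∈ involutions G := by
  simp only [mem_commutingInvolutions, mem_involutions]
  constructor
  · rintro ⟨⟨hx1, hx⟩, ⟨hy1, hy⟩, hne, hxy⟩
    refine ⟨⟨hx1, hx⟩, ⟨hy1, hy⟩, fun h => hne ?_, ?_⟩
    · rw [← mul_left_inj y, h, hy]
    · rw [hxy.symm.mul_mul_mul_comm, hx, hy, one_mul]
  · rintro ⟨⟨hx1, hx⟩, ⟨hy1, hy⟩, h1, h⟩
    refine ⟨⟨hx1, hx⟩, ⟨hy1, hy⟩, ?_, ?_⟩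
    · rintro rfl
      exact h1 hx
    · have e1 : x⁻¹ = x := inv_eq_of_mul_eq_one_left hx
      have e2 : y⁻¹ = y := inv_eq_of_mul_eq_one_left hy
      change x * y = y * x
      rw [← inv_eq_of_mul_eq_one_left h, _root_.mul_inv_rev, e1, e2]

variable {F : Type*} [Field F]

/-- The quotient map `SL₂(F) → PSL₂(F)`. -/
def toPSL2 (F : Type*) [Field F] : SpecialLinearGroup (Fin 2) F →* PSL2 F :=
  MonoidHom.rangeRestrict _

theorem toPSL2_surjective : Function.Surjective (toPSL2 F) :=
  MonoidHom.rangeRestrict_surjective _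

theorem toPSL2_eq_one_iff {A : SpecialLinearGroup (Fin 2) F} :
    toPSL2 F A = 1 ↔ A = 1 ∨ A = -1 := by
  have h : toPSL2 F A = 1 ↔ A ∈ Subgroup.center (SpecialLinearGroup (Fin 2) F) := by
    rw [← SpecialLinearGroup.toGL_mem_center_iff, ← QuotientGroup.eq_one_iff]
    exact Subtype.ext_iff
  rw [h, Matrix.SpecialLinearGroup.mem_center_iff]
  constructor
  · rintro ⟨r, hr, hA⟩
    rcases mul_self_eq_one_iff.1 (by simpa [sq] using hr) with rfl | rfl
    · left; ext i j; simp [← hA]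
    · right; ext i j; fin_cases i <;> fin_cases j <;> simp [← hA]
  · rintro (rfl | rfl)
    · exact ⟨1, by simp, by simp⟩
    · refine ⟨-1, by simp, ?_⟩
      ext i j
      fin_cases i <;> fin_cases j <;> simp

theorem toPSL2_eq_iff {A B : SpecialLinearGroup (Fin 2) F} :
    toPSL2 F A = toPSL2 F B ↔ A = B ∨ A = -B := by
  rw [← mul_inv_eq_one, ← map_inv, ← map_mul, toPSL2_eq_one_iff, mul_inv_eq_one,
    mul_inv_eq_iff_eq_mul, neg_one_mul]

theorem mul_self_apply_eq (A : SpecialLinearGroup (Fin 2) F) :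
    (A * A : SpecialLinearGroup (Fin 2) F).1 = (A 0 0 + A 1 1) • A.1 - 1 := by
  have h := A.det_coe
  rw [Matrix.det_fin_two] at h
  ext i j
  fin_cases i <;> fin_cases j <;>
    simp [Matrix.mul_apply, Fin.sum_univ_two] <;> first | linear_combination -h | linear_combination h | ring

theorem mul_apply_SL2 (A B : SpecialLinearGroup (Fin 2) F) (i j : Fin 2) :
    (A * B : SpecialLinearGroup (Fin 2) F) i j = A i 0 * B 0 j + A i 1 * B 1 j := by
  simp [Matrix.mul_apply, Fin.sum_univ_two]

theorem neg_one_ne_one_SL2 (h2 : (2 : F) ≠ 0) : (-1 : SpecialLinearGroup (Fin 2) F) ≠ 1 := by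
  intro h
  have := congrArg (fun A : SpecialLinearGroup (Fin 2) F => A 0 0) h
  simp at this
  exact h2 (by linear_combination -this)

theorem neg_ne_self_SL2 (h2 : (2 : F) ≠ 0) (A : SpecialLinearGroup (Fin 2) F) : -A ≠ A := by
  rw [← neg_one_mul, Ne, mul_eq_right]
  exact neg_one_ne_one_SL2 h2

theorem mul_self_eq_neg_one_iff {A : SpecialLinearGroup (Fin 2) F} :
    A * A = -1 ↔ A 0 0 + A 1 1 = 0 := by
  have h := mul_self_apply_eq A
  constructor
  · intro hA
    rw [hA] at h
    by_contra ht
    have hA0 : A.1 = 0 := by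
      have : (A 0 0 + A 1 1) • A.1 = 0 := by
        have hneg : (-1 : SpecialLinearGroup (Fin 2) F).1 = -1 := by
          ext i j
          fin_cases i <;> fin_cases j <;> simp
        rwa [hneg, eq_comm, sub_eq_neg_self] at h
      exact (smul_eq_zero.1 this).resolve_left ht
    have := A.2
    simp [hA0] at this
  · intro ht
    apply Subtype.ext
    rw [h, ht]
    simp

theorem eq_one_or_eq_neg_one_of_mul_self (h2 : (2 : F) ≠ 0) {A : SpecialLinearGroup (Fin 2) F}
    (hA : A * A = 1) : A = 1 ∨ A = -1 := by
  have h := mul_self_apply_eq A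
  rw [hA] at h
  have e00 := congrFun (congrFun h 0) 0
  have e01 := congrFun (congrFun h 0) 1
  have e10 := congrFun (congrFun h 1) 0
  have e11 := congrFun (congrFun h 1) 1
  simp at e00 e01 e10 e11
  have ht : A 0 0 + A 1 1 ≠ 0 := by
    intro ht
    rw [ht] at e00
    exact h2 (by linear_combination e00)
  have h01 := e01.resolve_left ht
  have h10 := e10.resolve_left ht
  have h11 : A 0 0 = A 1 1 := mul_left_cancel₀ ht (by linear_combination e11 - e00)
  have hd := A.det_coe
  rw [Matrix.det_fin_two, h01, h10, ← h11] at hd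
  have hs : A 0 0 = 1 ∨ A 0 0 = -1 := mul_self_eq_one_iff.1 (by linear_combination hd)
  rcases hs with hs | hs
  · left; ext i j; fin_cases i <;> fin_cases j <;> simp [h01, h10, ← h11, hs]
  · right; ext i j; fin_cases i <;> fin_cases j <;> simp [h01, h10, ← h11, hs]

theorem anticommute_of_mul_self {A B : SpecialLinearGroup (Fin 2) F} (hA : A * A = -1)
    (hB : B * B = -1) (hAB : A * B * (A * B) = -1) : A * B = -(B * A) := by
  have e : ∀ {C : SpecialLinearGroup (Fin 2) F}, C * C = -1 → C = -C⁻¹ := fun {C} hC => by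
    rw [eq_comm, neg_eq_iff_eq_neg, inv_eq_iff_mul_eq_one, mul_neg, hC, neg_neg]
  rw [e hAB, _root_.mul_inv_rev]
  conv_rhs => rw [e hA, e hB]
  simp

theorem toPSL2_mem_involutions_iff (h2 : (2 : F) ≠ 0) [Fintype (PSL2 F)]
    {A : SpecialLinearGroup (Fin 2) F} :
    toPSL2 F A ∈ involutions (PSL2 F) ↔ A * A = -1 := by
  rw [mem_involutions, ← map_mul, Ne, toPSL2_eq_one_iff, toPSL2_eq_one_iff]
  constructor
  · rintro ⟨h, h' | h'⟩
    · exact absurd (eq_one_or_eq_neg_one_of_mul_self h2 h') h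
    · exact h'
  · intro h
    refine ⟨?_, Or.inr h⟩
    rintro (rfl | rfl) <;> simp at h <;> exact neg_one_ne_one_SL2 h2 h.symm

theorem hasTwoRankLETwo_PSL2 (h2 : (2 : F) ≠ 0) [Fintype (PSL2 F)] :
    HasTwoRankLETwo (PSL2 F) := by
  intro x y z hx1 hy1 hne hx hy hz hxy hxz hyz
  by_contra! hcon
  obtain ⟨hz1, hzx, hzy, hzxy⟩ := hcon
  have hxi := mem_involutions.2 ⟨hx1, hx⟩
  have hyi := mem_involutions.2 ⟨hy1, hy⟩
  have hzi := mem_involutions.2 ⟨hz1, hz⟩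
  have pxy := (mem_commutingInvolutions_iff.1 (mem_commutingInvolutions.2 ⟨hxi, hyi, hne, hxy⟩)).2.2
  have pxz := (mem_commutingInvolutions_iff.1
    (mem_commutingInvolutions.2 ⟨hxi, hzi, hzx.symm, hxz⟩)).2.2
  have pyz := (mem_commutingInvolutions_iff.1
    (mem_commutingInvolutions.2 ⟨hyi, hzi, hzy.symm, hyz⟩)).2.2
  obtain ⟨A, rfl⟩ := toPSL2_surjective x
  obtain ⟨B, rfl⟩ := toPSL2_surjective y
  obtain ⟨C, rfl⟩ := toPSL2_surjective z
  simp only [← map_mul, toPSL2_mem_involutions_iff h2] at hxi hyi hzi pxy pxz pyz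
  have hAC := anticommute_of_mul_self hxi hzi pxz
  have hBC := anticommute_of_mul_self hyi hzi pyz
  have hABC : Commute (A * B) C := by
    change A * B * C = C * (A * B)
    rw [mul_assoc, hBC, mul_neg, ← mul_assoc, hAC, neg_mul, neg_neg, mul_assoc]
  have hsq : A * B * C * (A * B * C) = 1 := by
    rw [hABC.symm.mul_mul_mul_comm, pxy, hzi, neg_mul_neg, one_mul]
  have h1 := toPSL2_eq_one_iff.2 (eq_one_or_eq_neg_one_of_mul_self h2 hsq)
  rw [map_mul, map_mul] at h1
  exact hzxy (by rw [eq_inv_of_mul_eq_one_left h1]; exact (inv_eq_of_mul_eq_one_left hz).symm)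

section Card

variable [Fintype F] [DecidableEq F]

theorem card_filter_toPSL2 (h2 : (2 : F) ≠ 0) [DecidableEq (PSL2 F)] (x : PSL2 F) :
    ({A | toPSL2 F A = x} : Finset (SpecialLinearGroup (Fin 2) F)).card = 2 := by
  obtain ⟨B, rfl⟩ := toPSL2_surjective x
  have : ({A | toPSL2 F A = toPSL2 F B} : Finset (SpecialLinearGroup (Fin 2) F)) = {B, -B} := by
    ext A
    simp [toPSL2_eq_iff]
  rw [this, Finset.card_pair (neg_ne_self_SL2 h2 B).symm]

theorem card_mul_self_eq_neg_one :
    ({A | A * A = -1} : Finset (SpecialLinearGroup (Fin 2) F)).card =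
      ({t : F × F × F | t.1 ^ 2 + t.2.1 * t.2.2 = -1} : Finset (F × F × F)).card := by
  refine Finset.card_bij (fun B _ => (B 0 0, B 0 1, B 1 0)) ?_ ?_ ?_
  · intro B hB
    simp only [Finset.mem_filter, Finset.mem_univ, true_and, mul_self_eq_neg_one_iff] at hB ⊢
    have hd := B.det_coe
    rw [Matrix.det_fin_two] at hd
    linear_combination -hd + B 0 0 * hB
  · intro B hB C hC h
    simp only [Finset.mem_filter, Finset.mem_univ, true_and, mul_self_eq_neg_one_iff] at hB hC
    simp only [Prod.mk.injEq] at h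
    have h11 : B 1 1 = C 1 1 := by linear_combination hB - hC - h.1
    ext i j
    fin_cases i <;> fin_cases j
    exacts [h.1, h.2.1, h.2.2, h11]
  · rintro ⟨x, y, z⟩ h
    simp only [Finset.mem_filter, Finset.mem_univ, true_and] at h
    refine ⟨⟨!![x, y; z, -x], ?_⟩, ?_, rfl⟩
    · rw [Matrix.det_fin_two_of]
      linear_combination -h
    · exact Finset.mem_filter.2 ⟨Finset.mem_univ _, mul_self_eq_neg_one_iff.2 (add_neg_cancel x)⟩

theorem card_mul_self_eq_neg_one_of_anticommute {A : SpecialLinearGroup (Fin 2) F}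
    (hA : A * A = -1) :
    ({B | B * B = -1 ∧ A * B * (A * B) = -1} : Finset (SpecialLinearGroup (Fin 2) F)).card =
      ({t : F × F × F | t.1 ^ 2 + t.2.1 * t.2.2 = -1 ∧
        2 * A 0 0 * t.1 + A 0 1 * t.2.2 + A 1 0 * t.2.1 = 0} : Finset (F × F × F)).card := by
  rw [mul_self_eq_neg_one_iff] at hA
  refine Finset.card_bij (fun B _ => (B 0 0, B 0 1, B 1 0)) ?_ ?_ ?_
  · intro B hB
    simp only [Finset.mem_filter, Finset.mem_univ, true_and, mul_self_eq_neg_one_iff] at hB ⊢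
    have hd := B.det_coe
    rw [Matrix.det_fin_two] at hd
    obtain ⟨hB, hAB⟩ := hB
    rw [mul_apply_SL2, mul_apply_SL2] at hAB
    refine ⟨?_, ?_⟩
    · linear_combination -hd + B 0 0 * hB
    · linear_combination hAB - B 1 1 * hA + A 0 0 * hB
  · intro B hB C hC h
    simp only [Finset.mem_filter, Finset.mem_univ, true_and, mul_self_eq_neg_one_iff] at hB hC
    simp only [Prod.mk.injEq] at h
    have h11 : B 1 1 = C 1 1 := by linear_combination hB.1 - hC.1 - h.1
    ext i j
    fin_cases i <;> fin_cases j
    exacts [h.1, h.2.1, h.2.2, h11]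
  · rintro ⟨x, y, z⟩ h
    simp only [Finset.mem_filter, Finset.mem_univ, true_and] at h
    refine ⟨⟨!![x, y; z, -x], ?_⟩, ?_, rfl⟩
    · rw [Matrix.det_fin_two_of]
      linear_combination -h.1
    · refine Finset.mem_filter.2 ⟨Finset.mem_univ _, mul_self_eq_neg_one_iff.2 (add_neg_cancel x),
        mul_self_eq_neg_one_iff.2 ?_⟩
      refine Eq.trans (congrArg₂ (· + ·) (mul_apply_SL2 A _ 0 0) (mul_apply_SL2 A _ 1 1)) ?_
      change A 0 0 * x + A 0 1 * z + (A 1 0 * y + A 1 1 * -x) = 0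
      linear_combination h.2 - x * hA

theorem two_mul_card_involutions_PSL2 [Fintype (PSL2 F)] (hF : ringChar F ≠ 2) :
    2 * ((involutions (PSL2 F)).card : ℤ) =
      Fintype.card F * (Fintype.card F + quadraticChar F (-1)) := by
  classical
  have h2 : (2 : F) ≠ 0 := Ring.two_ne_zero hF
  rw [← card_sq_add_mul_eq_neg_one hF, ← card_mul_self_eq_neg_one,
    card_eq_mul_of_card_fiber_eq (t := involutions (PSL2 F)) (f := toPSL2 F) (k := 2)]
  · push_cast; ring
  · intro A hA
    exact (toPSL2_mem_involutions_iff h2).2 (by simpa using hA)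
  · intro x hx
    refine Eq.trans (congrArg _ ?_) (card_filter_toPSL2 h2 x)
    ext A
    simp only [Finset.mem_filter, Finset.mem_univ, true_and, and_iff_right_iff_imp]
    rintro rfl
    exact (toPSL2_mem_involutions_iff h2).1 hx

theorem four_mul_card_commutingInvolutions_PSL2 [Fintype (PSL2 F)] (hF : ringChar F ≠ 2) :
    4 * ((commutingInvolutions (PSL2 F)).card : ℤ) =
      Fintype.card F * (Fintype.card F + quadraticChar F (-1)) *
        (Fintype.card F - quadraticChar F (-1)) := by
  classical
  have h2 : (2 : F) ≠ 0 := Ring.two_ne_zero hF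
  let s : Finset (Σ _ : SpecialLinearGroup (Fin 2) F, SpecialLinearGroup (Fin 2) F) :=
    ({A | A * A = -1} : Finset (SpecialLinearGroup (Fin 2) F)).sigma
      fun A => {B | B * B = -1 ∧ A * B * (A * B) = -1}
  have hs : ∀ A B, (⟨A, B⟩ : Σ _ : SpecialLinearGroup (Fin 2) F, SpecialLinearGroup (Fin 2) F) ∈ s ↔
      (toPSL2 F A, toPSL2 F B) ∈ commutingInvolutions (PSL2 F) := by
    intro A B
    rw [mem_commutingInvolutions_iff, ← map_mul, toPSL2_mem_involutions_iff h2,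
      toPSL2_mem_involutions_iff h2, toPSL2_mem_involutions_iff h2]
    simp [s]
  have h1 : (s.card : ℤ) = Fintype.card F * (Fintype.card F + quadraticChar F (-1)) *
      (Fintype.card F - quadraticChar F (-1)) := by
    rw [Finset.card_sigma, Nat.cast_sum, Finset.sum_congr rfl (g := fun _ =>
      (Fintype.card F - quadraticChar F (-1) : ℤ)), Finset.sum_const, nsmul_eq_mul,
      card_mul_self_eq_neg_one, card_sq_add_mul_eq_neg_one hF]
    intro A hA
    have hA' : A * A = -1 := by simpa using hA
    rw [card_mul_self_eq_neg_one_of_anticommute hA', card_orthogonal hF]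
    rw [mul_self_eq_neg_one_iff] at hA'
    have hd := A.det_coe
    rw [Matrix.det_fin_two] at hd
    linear_combination -hd + A 0 0 * hA'
  rw [← h1, card_eq_mul_of_card_fiber_eq (t := commutingInvolutions (PSL2 F))
    (s := s) (f := fun p => (toPSL2 F p.1, toPSL2 F p.2)) (k := 2 * 2)]
  · push_cast; ring
  · rintro ⟨A, B⟩ hp
    exact (hs A B).1 hp
  · rintro ⟨x, y⟩ hx
    refine Eq.trans ?_ (congrArg₂ (· * ·) (card_filter_toPSL2 h2 x) (card_filter_toPSL2 h2 y))
    rw [← Finset.card_product]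
    refine Finset.card_bij (fun p _ => (p.1, p.2)) ?_ ?_ ?_
    · rintro ⟨A, B⟩ hp
      simpa using (Finset.mem_filter.1 hp).2
    · rintro ⟨A, B⟩ _ ⟨C, D⟩ _ h
      simpa using h
    · rintro ⟨A, B⟩ hp
      simp only [Finset.mem_product, Finset.mem_filter, Finset.mem_univ, true_and] at hp
      refine ⟨⟨A, B⟩, Finset.mem_filter.2 ⟨(hs A B).2 ?_, ?_⟩, rfl⟩
      · rwa [hp.1, hp.2]
      · simp [hp.1, hp.2]

end Card

end ProjectiveSpecialLinear

/-- For an odd prime power `q` with `q ≡ ε (mod 4)`, `ε = ±1`: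
`12·χ̃(A₂(PSL₂(q))) = -(q-ε)(q² - (6-ε)q - 12ε)`. -/
theorem reducedEulerChar_PSL2 (q : ℕ) (hq : IsPrimePow q) (hodd : Odd q)
    (ε : ℤ) (hε : ε = 1 ∨ ε = -1) (hmod : (q : ℤ) ≡ ε [ZMOD 4])
    (F : Type*) [Field F] [Fintype F] (hF : Fintype.card F = q) :
    12 * reducedEulerChar 2 (PSL2 F) =
      -(((q : ℤ) - ε) * ((q : ℤ) ^ 2 - (6 - ε) * (q : ℤ) - 12 * ε)) := by
  classical
  have : Fintype (PSL2 F) := Fintype.ofSurjective (toPSL2 F) toPSL2_surjective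
  have hchar : ringChar F ≠ 2 := by
    intro h
    rw [FiniteField.even_card_iff_char_two, hF] at h
    exact Nat.not_even_iff_odd.2 hodd (Nat.even_iff.2 h)
  have hχ : quadraticChar F (-1) = ε := by
    rw [quadraticChar_neg_one hchar, hF]
    rcases hε with rfl | rfl
    · exact ZMod.χ₄_nat_one_mod_four (by have := hmod; unfold Int.ModEq at this; omega)
    · exact ZMod.χ₄_nat_three_mod_four (by have := hmod; unfold Int.ModEq at this; omega)
  have hε2 : ε ^ 2 = 1 := by rcases hε with rfl | rfl <;> norm_num
  have hI := two_mul_card_involutions_PSL2 hchar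
  have hP := four_mul_card_commutingInvolutions_PSL2 hchar
  have hE := three_mul_reducedEulerChar_two (hasTwoRankLETwo_PSL2 (Ring.two_ne_zero hchar))
  rw [hχ, hF] at hI hP
  linear_combination 4 * hE + 6 * hI - hP + 12 * hε2
end

section
/- Let q be an odd prime power. Then the reduced Euler characteristic of A_2(PSL_3(q)) satisfies 3·χ̃(A_2(PSL_3(q))) = -(q-1)(q²-1)(q³ + 3q² + 3q + 3), and moreover χ̃(A_2(PGL_3(q))) = χ̃(A_2(PSL_3(q))). -/
/-- `PGL₃(F)`: the quotient of `GL(3,F)` by its center. -/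
abbrev PGL3 (F : Type*) [Field F] :=
  Matrix.GeneralLinearGroup (Fin 3) F ⧸ Subgroup.center (Matrix.GeneralLinearGroup (Fin 3) F)

/-- `PSL₃(F)`: the image of `SL(3,F)` in `PGL₃(F)` under the natural map. -/
def PSL3 (F : Type*) [Field F] : Subgroup (PGL3 F) :=
  ((QuotientGroup.mk' (Subgroup.center (Matrix.GeneralLinearGroup (Fin 3) F))).comp
    Matrix.SpecialLinearGroup.toGL).range

section TwoSubgroups

variable {G : Type*} [Group G]

/-- `x` is an element of order two. -/
def IsInvol (x : G) : Prop := x * x = 1 ∧ x ≠ 1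

/-- `x` and `y` are distinct commuting involutions. -/
def IsCommPair (x y : G) : Prop := IsInvol x ∧ IsInvol y ∧ x ≠ y ∧ x * y = y * x

theorem IsCommPair.symm {x y : G} (h : IsCommPair x y) : IsCommPair y x :=
  ⟨h.2.1, h.1, h.2.2.1.symm, h.2.2.2.symm⟩

theorem IsCommPair.mul_cancel_left {x y : G} (h : IsCommPair x y) : x * (x * y) = y := by
  rw [← mul_assoc, h.1.1, one_mul]

theorem IsCommPair.mul_cancel_right {x y : G} (h : IsCommPair x y) : y * (x * y) = x := by
  rw [h.2.2.2, h.symm.mul_cancel_left]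

theorem IsCommPair.ne_mul {x y : G} (h : IsCommPair x y) : x ≠ x * y := by
  intro e
  exact h.2.1.2 (mul_eq_left.mp e.symm)

theorem IsCommPair.mul_ne_one {x y : G} (h : IsCommPair x y) : x * y ≠ 1 := by
  intro e
  have := h.mul_cancel_left
  rw [e, mul_one] at this
  exact h.2.2.1 this

theorem IsCommPair.right_mul {x y : G} (h : IsCommPair x y) : IsCommPair x (x * y) := by
  refine ⟨h.1, ⟨?_, h.mul_ne_one⟩, h.ne_mul, ?_⟩
  · rw [mul_assoc, h.mul_cancel_right, h.1.1]
  · rw [h.mul_cancel_left, h.2.2.2, mul_assoc, h.1.1, mul_one]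

theorem IsCommPair.mem_closure_iff {x y : G} (h : IsCommPair x y) {z : G} :
    z ∈ Subgroup.closure {x, y} ↔ z = 1 ∨ z = x ∨ z = y ∨ z = x * y := by
  constructor
  · intro hz
    have hxx := h.1.1
    have hyy := h.2.1.1
    have hyx : y * x = x * y := h.2.2.2.symm
    have h1 := h.mul_cancel_left
    have h2 := h.mul_cancel_right
    have h3 : x * y * x = y := by rw [mul_assoc, hyx, h1]
    have h4 : x * y * y = x := by rw [mul_assoc, hyy, mul_one]
    have h5 : x * y * (x * y) = 1 := h.right_mul.2.1.1
    induction hz using Subgroup.closure_induction with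
    | mem z hz => rcases hz with rfl | rfl <;> simp
    | one => simp
    | mul a b _ _ ha hb =>
      rcases ha with rfl | rfl | rfl | rfl <;> rcases hb with rfl | rfl | rfl | rfl <;>
        simp [hxx, hyy, hyx, h1, h2, h3, h4, h5]
    | inv a _ ha =>
      rcases ha with rfl | rfl | rfl | rfl
      · simp
      · rw [← eq_inv_of_mul_eq_one_left hxx]; simp
      · rw [← eq_inv_of_mul_eq_one_left hyy]; simp
      · rw [← eq_inv_of_mul_eq_one_left h5]; simp
  · have hx : x ∈ Subgroup.closure {x, y} := Subgroup.subset_closure (by simp)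
    have hy : y ∈ Subgroup.closure {x, y} := Subgroup.subset_closure (by simp)
    rintro (rfl | rfl | rfl | rfl)
    · exact one_mem _
    · exact hx
    · exact hy
    · exact mul_mem hx hy

theorem IsInvol.mem_zpowers_iff {x z : G} (h : IsInvol x) :
    z ∈ Subgroup.zpowers x ↔ z = 1 ∨ z = x := by
  constructor
  · rintro ⟨n, rfl⟩
    rcases Int.even_or_odd' n with ⟨k, rfl | rfl⟩
    · left; simp [zpow_mul, pow_two, h.1]
    · right; simp [zpow_add, zpow_mul, pow_two, h.1]
  · rintro (rfl | rfl)
    · exact one_mem _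
    · exact Subgroup.mem_zpowers _

/-- Every elementary abelian `2`-subgroup of `G` has rank at most two. -/
def TwoRankLETwo (G : Type*) [Group G] : Prop :=
  ∀ x y z : G, IsCommPair x y → IsCommPair x z → IsCommPair y z → z = x * y

theorem isCommPair_of_mem {H : Subgroup G} (hH : ∀ x ∈ H, x * x = 1) {x y : G} (hx : x ∈ H)
    (hy : y ∈ H) (hx1 : x ≠ 1) (hy1 : y ≠ 1) (hxy : x ≠ y) : IsCommPair x y := by
  refine ⟨⟨hH x hx, hx1⟩, ⟨hH y hy, hy1⟩, hxy, ?_⟩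
  rw [eq_inv_of_mul_eq_one_left (hH _ (mul_mem hx hy)), mul_inv_rev,
    ← eq_inv_of_mul_eq_one_left (hH x hx), ← eq_inv_of_mul_eq_one_left (hH y hy)]

theorem eq_closure_of_mem (hr : TwoRankLETwo G) {H : Subgroup G} (hH : ∀ x ∈ H, x * x = 1)
    {x y : G} (hx : x ∈ H) (hy : y ∈ H) (hx1 : x ≠ 1) (hy1 : y ≠ 1) (hxy : x ≠ y) :
    H = Subgroup.closure {x, y} := by
  have h := isCommPair_of_mem hH hx hy hx1 hy1 hxy
  ext z
  rw [h.mem_closure_iff]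
  constructor
  · intro hz
    by_contra! hc
    exact hc.2.2.2 (hr x y z h (isCommPair_of_mem hH hx hz hx1 hc.1 hc.2.1.symm)
      (isCommPair_of_mem hH hy hz hy1 hc.1 hc.2.2.1.symm))
  · rintro (rfl | rfl | rfl | rfl)
    · exact one_mem _
    · exact hx
    · exact hy
    · exact mul_mem hx hy

theorem exists_mem_ne_one {H : Subgroup G} (hH : H ≠ ⊥) : ∃ x ∈ H, x ≠ 1 := by
  by_contra! h
  exact hH ((Subgroup.eq_bot_iff_forall H).mpr h)

theorem eq_zpowers_or_eq_closure (hr : TwoRankLETwo G) {H : Subgroup G}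
    (hH : ∀ x ∈ H, x * x = 1) (hb : H ≠ ⊥) :
    (∃ x, IsInvol x ∧ Subgroup.zpowers x = H) ∨
      ∃ x y, IsCommPair x y ∧ Subgroup.closure {x, y} = H := by
  obtain ⟨x, hx, hx1⟩ := exists_mem_ne_one hb
  by_cases hy : ∃ y ∈ H, y ≠ 1 ∧ x ≠ y
  · obtain ⟨y, hy, hy1, hxy⟩ := hy
    exact Or.inr ⟨x, y, isCommPair_of_mem hH hx hy hx1 hy1 hxy,
      (eq_closure_of_mem hr hH hx hy hx1 hy1 hxy).symm⟩
  · push Not at hy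
    have hix : IsInvol x := ⟨hH x hx, hx1⟩
    refine Or.inl ⟨x, hix, ?_⟩
    ext z
    rw [hix.mem_zpowers_iff]
    constructor
    · rintro (rfl | rfl)
      · exact one_mem _
      · exact hx
    · intro hz
      by_cases h1 : z = 1
      · exact Or.inl h1
      · exact Or.inr (hy z hz h1).symm

theorem lt_pair (hr : TwoRankLETwo G) {H K : Subgroup G} (hK : ∀ x ∈ K, x * x = 1)
    (hb : H ≠ ⊥) (hHK : H < K) :
    ∃ x y, IsCommPair x y ∧ Subgroup.zpowers x = H ∧ Subgroup.closure {x, y} = K := by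
  obtain ⟨x, hx, hx1⟩ := exists_mem_ne_one hb
  obtain ⟨y, hy, hyH⟩ := SetLike.exists_of_lt hHK
  have hy1 : y ≠ 1 := fun h => hyH (h ▸ one_mem _)
  have hxy : x ≠ y := fun h => hyH (h ▸ hx)
  have hp := isCommPair_of_mem hK (hHK.le hx) hy hx1 hy1 hxy
  have hcl := eq_closure_of_mem hr hK (hHK.le hx) hy hx1 hy1 hxy
  refine ⟨x, y, hp, ?_, hcl.symm⟩
  ext z
  rw [hp.1.mem_zpowers_iff]
  constructor
  · rintro (rfl | rfl)
    · exact one_mem _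
    · exact hx
  · intro hz
    have := hHK.le hz
    rw [hcl, hp.mem_closure_iff] at this
    rcases this with h | h | rfl | rfl
    · exact Or.inl h
    · exact Or.inr h
    · exact absurd hz hyH
    · exact absurd (by simpa using mul_mem (inv_mem hx) hz) hyH

theorem apChainCount_eq_zero [Finite G] (hr : TwoRankLETwo G) {k : ℕ} (hk : 2 ≤ k) :
    apChainCount 2 G k = 0 := by
  rw [apChainCount, Nat.card_eq_zero]
  left
  refine ⟨fun ⟨c, hc, h⟩ => ?_⟩
  simp only [isElementaryAbelian_two_iff] at h
  have h01 : c ⟨0, by omega⟩ < c ⟨1, by omega⟩ := hc (Fin.mk_lt_mk.mpr (by omega))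
  have h12 : c ⟨1, by omega⟩ < c ⟨2, by omega⟩ := hc (Fin.mk_lt_mk.mpr (by omega))
  obtain ⟨x, y, hp, -, h1⟩ := lt_pair hr (h _).1 (h _).2 h01
  have hx : x ∈ c ⟨1, by omega⟩ := h1 ▸ Subgroup.subset_closure (by simp)
  have hy : y ∈ c ⟨1, by omega⟩ := h1 ▸ Subgroup.subset_closure (by simp)
  have h2 := eq_closure_of_mem hr (h ⟨2, by omega⟩).1 (h12.le hx) (h12.le hy) hp.1.2 hp.2.1.2
    hp.2.2.1
  exact h12.ne (h1.symm.trans h2.symm)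

open Classical in
/-- The set of involutions of a finite group. -/
noncomputable def involSet (G : Type*) [Group G] [Fintype G] : Finset G := {x | IsInvol x}

open Classical in
/-- The set of ordered pairs of distinct commuting involutions of a finite group. -/
noncomputable def commPairSet (G : Type*) [Group G] [Fintype G] : Finset (G × G) :=
  {p | IsCommPair p.1 p.2}

theorem mem_involSet [Fintype G] {x : G} : x ∈ involSet G ↔ IsInvol x := by simp [involSet]

theorem mem_commPairSet [Fintype G] {p : G × G} : p ∈ commPairSet G ↔ IsCommPair p.1 p.2 := by
  simp [commPairSet]

theorem IsCommPair.sq_of_mem_closure {x y z : G} (h : IsCommPair x y)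
    (hz : z ∈ Subgroup.closure {x, y}) : z * z = 1 := by
  rcases h.mem_closure_iff.mp hz with rfl | rfl | rfl | rfl
  · simp
  · exact h.1.1
  · exact h.2.1.1
  · exact h.right_mul.2.1.1

theorem IsCommPair.closure_eq_closure_iff {x y a b : G} (h : IsCommPair x y)
    (h' : IsCommPair a b) (hr : TwoRankLETwo G) :
    Subgroup.closure {a, b} = Subgroup.closure {x, y} ↔
      (a = x ∨ a = y ∨ a = x * y) ∧ (b = x ∨ b = y ∨ b = x * y) := by
  constructor
  · intro e
    have ha : a ∈ Subgroup.closure {x, y} := e ▸ Subgroup.subset_closure (by simp)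
    have hb : b ∈ Subgroup.closure {x, y} := e ▸ Subgroup.subset_closure (by simp)
    exact ⟨(h.mem_closure_iff.mp ha).resolve_left h'.1.2,
      (h.mem_closure_iff.mp hb).resolve_left h'.2.1.2⟩
  · rintro ⟨ha, hb⟩
    exact (eq_closure_of_mem hr (fun z hz => h.sq_of_mem_closure hz)
      (h.mem_closure_iff.mpr (Or.inr ha)) (h.mem_closure_iff.mpr (Or.inr hb)) h'.1.2 h'.2.1.2 h'.2.2.1).symm

theorem zpowers_injOn : Set.InjOn Subgroup.zpowers {x : G | IsInvol x} := by
  intro x hx y hy hxy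
  have : x ∈ Subgroup.zpowers y := hxy ▸ Subgroup.mem_zpowers x
  exact (hy.mem_zpowers_iff.mp this).resolve_left hx.2

open Classical in
theorem six_mul_card_fourGroups [Fintype G] (hr : TwoRankLETwo G) :
    (commPairSet G).card =
      ((commPairSet G).image fun p => Subgroup.closure {p.1, p.2}).card * 6 := by
  rw [Finset.card_eq_sum_card_image (fun p : G × G => Subgroup.closure {p.1, p.2})
    (commPairSet G)]
  refine Finset.sum_const_nat fun K hK => ?_
  obtain ⟨⟨x, y⟩, hp, rfl⟩ := Finset.mem_image.mp hK
  have h : IsCommPair x y := mem_commPairSet.mp hp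
  have : {p ∈ commPairSet G | Subgroup.closure {p.1, p.2} = Subgroup.closure {x, y}} =
      ({x, y, x * y} : Finset G).offDiag := by
    ext ⟨a, b⟩
    simp only [Finset.mem_filter, mem_commPairSet, Finset.mem_offDiag, Finset.mem_insert,
      Finset.mem_singleton]
    constructor
    · rintro ⟨hab, e⟩
      have := (h.closure_eq_closure_iff hab hr).mp e
      exact ⟨this.1, this.2, hab.2.2.1⟩
    · rintro ⟨ha, hb, hab⟩
      have ha1 : a ≠ 1 := by
        rcases ha with rfl | rfl | rfl
        exacts [h.1.2, h.2.1.2, h.mul_ne_one]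
      have hb1 : b ≠ 1 := by
        rcases hb with rfl | rfl | rfl
        exacts [h.1.2, h.2.1.2, h.mul_ne_one]
      have hc := isCommPair_of_mem (fun z hz => h.sq_of_mem_closure hz)
        (h.mem_closure_iff.mpr (Or.inr ha)) (h.mem_closure_iff.mpr (Or.inr hb)) ha1 hb1 hab
      exact ⟨hc, (h.closure_eq_closure_iff hc hr).mpr ⟨ha, hb⟩⟩
  rw [this, Finset.offDiag_card, Finset.card_eq_three.mpr
    ⟨x, y, x * y, h.2.2.1, h.ne_mul, by rw [h.2.2.2]; exact h.symm.ne_mul, rfl⟩]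

open Classical in
theorem two_mul_card_flags [Fintype G] (hr : TwoRankLETwo G) :
    (commPairSet G).card =
      ((commPairSet G).image
        fun p => (Subgroup.zpowers p.1, Subgroup.closure {p.1, p.2})).card * 2 := by
  rw [Finset.card_eq_sum_card_image
    (fun p : G × G => (Subgroup.zpowers p.1, Subgroup.closure {p.1, p.2})) (commPairSet G)]
  refine Finset.sum_const_nat fun K hK => ?_
  obtain ⟨⟨x, y⟩, hp, rfl⟩ := Finset.mem_image.mp hK
  have h : IsCommPair x y := mem_commPairSet.mp hp
  rw [Finset.card_eq_two]
  refine ⟨(x, y), (x, x * y), ?_, ?_⟩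
  · intro e
    have : y = x * y := congrArg Prod.snd e
    rw [h.2.2.2] at this
    exact h.symm.ne_mul this
  · ext ⟨a, b⟩
    simp only [Finset.mem_filter, mem_commPairSet, Finset.mem_insert, Finset.mem_singleton,
      Prod.mk.injEq]
    constructor
    · rintro ⟨hab, e1, e2⟩
      obtain rfl : a = x := zpowers_injOn hab.1 h.1 e1
      have := ((h.closure_eq_closure_iff hab hr).mp e2).2.resolve_left hab.2.2.1.symm
      exact this.imp (⟨rfl, ·⟩) (⟨rfl, ·⟩)
    · rintro (⟨rfl, rfl⟩ | ⟨rfl, rfl⟩)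
      · exact ⟨h, rfl, rfl⟩
      · exact ⟨h.right_mul, rfl, (h.closure_eq_closure_iff h.right_mul hr).mpr (by simp)⟩

theorem IsCommPair.zpowers_lt_closure {x y : G} (h : IsCommPair x y) :
    Subgroup.zpowers x < Subgroup.closure {x, y} := by
  refine lt_of_le_of_ne ?_ ?_
  · exact Subgroup.zpowers_le.mpr (Subgroup.subset_closure (by simp))
  · intro e
    have : y ∈ Subgroup.zpowers x := e ▸ Subgroup.subset_closure (by simp)
    rcases h.1.mem_zpowers_iff.mp this with h1 | h1
    · exact h.2.1.2 h1
    · exact h.2.2.1 h1.symm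

theorem IsInvol.sq_of_mem_zpowers {x z : G} (h : IsInvol x) (hz : z ∈ Subgroup.zpowers x) :
    z * z = 1 := by
  rcases h.mem_zpowers_iff.mp hz with rfl | rfl
  · simp
  · exact h.1

open Classical in
theorem apChainCount_zero_s18 [Fintype G] (hr : TwoRankLETwo G) :
    apChainCount 2 G 0 = (involSet G).card +
      ((commPairSet G).image fun p => Subgroup.closure {p.1, p.2}).card := by
  have h1 : apChainCount 2 G 0 =
      Nat.card {H : Subgroup G // (∀ x ∈ H, x * x = 1) ∧ H ≠ ⊥} := by
    refine Nat.card_congr (Equiv.subtypeEquiv (Equiv.funUnique (Fin 1) (Subgroup G)) ?_)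
    intro c
    simp [isElementaryAbelian_two_iff, Subsingleton.strictMono]
  rw [h1, ← Finset.card_image_of_injOn (f := Subgroup.zpowers) (s := involSet G),
    ← Finset.card_union_of_disjoint]
  · refine Nat.subtype_card _ fun H => ?_
    simp only [Finset.mem_union, Finset.mem_image, mem_involSet, mem_commPairSet, Prod.exists]
    constructor
    · rintro (⟨x, hx, rfl⟩ | ⟨x, y, h, rfl⟩)
      · exact ⟨fun z hz => hx.sq_of_mem_zpowers hz, by simpa using hx.2⟩
      · exact ⟨fun z hz => h.sq_of_mem_closure hz, (bot_le.trans_lt h.zpowers_lt_closure).ne'⟩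
    · rintro ⟨hH, hb⟩
      exact eq_zpowers_or_eq_closure hr hH hb
  · rw [Finset.disjoint_left]
    intro H
    simp only [Finset.mem_image, mem_involSet, mem_commPairSet, Prod.exists]
    rintro ⟨z, hz, rfl⟩ ⟨x, y, h, e⟩
    have hx : x ∈ Subgroup.zpowers z := e ▸ Subgroup.subset_closure (by simp)
    have hy : y ∈ Subgroup.zpowers z := e ▸ Subgroup.subset_closure (by simp)
    rw [hz.mem_zpowers_iff] at hx hy
    exact h.2.2.1 ((hx.resolve_left h.1.2).trans (hy.resolve_left h.2.1.2).symm)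
  · intro x hx y hy
    exact zpowers_injOn (mem_involSet.mp hx) (mem_involSet.mp hy)

open Classical in
theorem apChainCount_one_s18 [Fintype G] (hr : TwoRankLETwo G) :
    apChainCount 2 G 1 = ((commPairSet G).image
        fun p => (Subgroup.zpowers p.1, Subgroup.closure {p.1, p.2})).card := by
  have h1 : apChainCount 2 G 1 =
      Nat.card {H : Subgroup G × Subgroup G //
        H.1 < H.2 ∧ H.1 ≠ ⊥ ∧ ∀ x ∈ H.2, x * x = 1} := by
    refine Nat.card_congr (Equiv.subtypeEquiv (finTwoArrowEquiv (Subgroup G)) ?_)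
    intro c
    simp only [isElementaryAbelian_two_iff, Fin.strictMono_iff_lt_succ, Fin.forall_fin_one]
    constructor
    · rintro ⟨h, h0⟩
      exact ⟨h, (h0 0).2, (h0 1).1⟩
    · rintro ⟨h, h0, h1⟩
      refine ⟨h, Fin.forall_fin_two.mpr ⟨⟨fun x hx => h1 x (h.le hx), h0⟩, h1, ?_⟩⟩
      exact (bot_le.trans_lt h).ne'
  rw [h1]
  refine Nat.subtype_card _ fun H => ?_
  simp only [Finset.mem_image, mem_commPairSet, Prod.exists]
  constructor
  · rintro ⟨x, y, h, rfl⟩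
    exact ⟨h.zpowers_lt_closure, by simpa using h.1.2, fun z hz => h.sq_of_mem_closure hz⟩
  · rintro ⟨h, hb, hK⟩
    obtain ⟨x, y, hp, e1, e2⟩ := lt_pair hr hK hb h
    exact ⟨x, y, hp, Prod.ext e1 e2⟩

theorem three_mul_reducedEulerChar_two_s18 [Fintype G] (hr : TwoRankLETwo G) :
    3 * reducedEulerChar 2 G =
      -3 + 3 * ((involSet G).card : ℤ) - ((commPairSet G).card : ℤ) := by
  classical
  have hs : Function.support (fun k : ℕ => (-1 : ℤ) ^ k * (apChainCount 2 G k : ℤ)) ⊆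
      (Finset.range 2 : Finset ℕ) := by
    intro k hk
    by_contra hc
    have : 2 ≤ k := by simpa [Nat.lt_iff_add_one_le] using hc
    exact hk (by simp [apChainCount_eq_zero hr this])
  rw [reducedEulerChar, finsum_eq_sum_of_support_subset _ hs, Finset.sum_range_succ,
    Finset.sum_range_one, apChainCount_zero_s18 hr, apChainCount_one_s18 hr]
  have h6 := six_mul_card_fourGroups hr
  have h2 := two_mul_card_flags hr
  push_cast
  omega

/-- A homomorphism that identifies the solutions of `x * x = 1` in its source and target,
and that reflects commutation between them. -/
structure IsInvolIso {H : Type*} [Group H] (f : H →* G) : Prop where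
  inj : ∀ x y, x * x = 1 → y * y = 1 → f x = f y → x = y
  surj : ∀ y, y * y = 1 → ∃ x, x * x = 1 ∧ f x = y
  comm : ∀ x y, x * x = 1 → y * y = 1 → f x * f y = f y * f x → x * y = y * x

namespace IsInvolIso

variable {H : Type*} [Group H] {f : H →* G}

theorem map_isInvol (hf : IsInvolIso f) {x : H} (hx : IsInvol x) : IsInvol (f x) := by
  refine ⟨by rw [← map_mul, hx.1, map_one], fun h => hx.2 ?_⟩
  exact hf.inj x 1 hx.1 (one_mul 1) (h.trans f.map_one.symm)

theorem exists_isInvol (hf : IsInvolIso f) {y : G} (hy : IsInvol y) :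
    ∃ x, IsInvol x ∧ f x = y := by
  obtain ⟨x, hx, rfl⟩ := hf.surj y hy.1
  exact ⟨x, ⟨hx, fun h => hy.2 (by rw [h, map_one])⟩, rfl⟩

theorem isCommPair_map_iff (hf : IsInvolIso f) {x y : H} (hx : IsInvol x) (hy : IsInvol y) :
    IsCommPair (f x) (f y) ↔ IsCommPair x y := by
  constructor
  · intro h
    exact ⟨hx, hy, fun e => h.2.2.1 (e ▸ rfl), hf.comm x y hx.1 hy.1 h.2.2.2⟩
  · intro h
    exact ⟨hf.map_isInvol hx, hf.map_isInvol hy, fun e => h.2.2.1 (hf.inj x y hx.1 hy.1 e),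
      by rw [← map_mul, h.2.2.2, map_mul]⟩

theorem twoRankLETwo (hf : IsInvolIso f) (hr : TwoRankLETwo H) : TwoRankLETwo G := by
  intro a b c hab hac hbc
  obtain ⟨x, hx, rfl⟩ := hf.exists_isInvol hab.1
  obtain ⟨y, hy, rfl⟩ := hf.exists_isInvol hab.2.1
  obtain ⟨z, hz, rfl⟩ := hf.exists_isInvol hac.2.1
  rw [hf.isCommPair_map_iff hx hy] at hab
  rw [hf.isCommPair_map_iff hx hz] at hac
  rw [hf.isCommPair_map_iff hy hz] at hbc
  rw [hr x y z hab hac hbc, map_mul]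

theorem card_involSet [Fintype G] [Fintype H] (hf : IsInvolIso f) :
    (involSet G).card = (involSet H).card := by
  symm
  refine Finset.card_bij (fun x _ => f x) ?_ ?_ ?_
  · intro x hx
    exact mem_involSet.mpr (hf.map_isInvol (mem_involSet.mp hx))
  · intro x hx y hy h
    exact hf.inj x y (mem_involSet.mp hx).1 (mem_involSet.mp hy).1 h
  · intro y hy
    obtain ⟨x, hx, h⟩ := hf.exists_isInvol (mem_involSet.mp hy)
    exact ⟨x, mem_involSet.mpr hx, h⟩

theorem card_commPairSet [Fintype G] [Fintype H] (hf : IsInvolIso f) :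
    (commPairSet G).card = (commPairSet H).card := by
  symm
  refine Finset.card_bij (fun p _ => (f p.1, f p.2)) ?_ ?_ ?_
  · intro p hp
    have h := mem_commPairSet.mp hp
    exact mem_commPairSet.mpr ((hf.isCommPair_map_iff h.1 h.2.1).mpr h)
  · intro p hp p' hp' e
    have h := mem_commPairSet.mp hp
    have h' := mem_commPairSet.mp hp'
    exact Prod.ext (hf.inj _ _ h.1.1 h'.1.1 (congrArg Prod.fst e))
      (hf.inj _ _ h.2.1.1 h'.2.1.1 (congrArg Prod.snd e))
  · rintro ⟨a, b⟩ h
    have h := mem_commPairSet.mp h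
    obtain ⟨x, hx, rfl⟩ := hf.exists_isInvol h.1
    obtain ⟨y, hy, rfl⟩ := hf.exists_isInvol h.2.1
    exact ⟨(x, y), mem_commPairSet.mpr ((hf.isCommPair_map_iff hx hy).mp h), rfl⟩

end IsInvolIso

end TwoSubgroups

section Projective

open Matrix

variable {F : Type*} [Field F]

theorem sl_mul_eq_one_iff {x y : SpecialLinearGroup (Fin 3) F} :
    x * y = 1 ↔ (x : Matrix (Fin 3) (Fin 3) F) * (y : Matrix (Fin 3) (Fin 3) F) = 1 := by
  exact Subtype.ext_iff

theorem mk_eq_mk_iff_exists_smul {a b : SpecialLinearGroup (Fin 3) F}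
    (h : (QuotientGroup.mk (SpecialLinearGroup.toGL a) : PGL3 F) =
      QuotientGroup.mk (SpecialLinearGroup.toGL b)) :
    ∃ c : F, c ^ 3 = 1 ∧ (b : Matrix (Fin 3) (Fin 3) F) = c • (a : Matrix (Fin 3) (Fin 3) F) := by
  rw [QuotientGroup.eq, GeneralLinearGroup.mem_center_iff_val_mem_range_scalar] at h
  obtain ⟨c, hc⟩ := h
  have hb : (b : Matrix (Fin 3) (Fin 3) F) = c • (a : Matrix (Fin 3) (Fin 3) F) := by
    have h1 : ((SpecialLinearGroup.toGL b : GL (Fin 3) F) : Matrix (Fin 3) (Fin 3) F) =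
        (SpecialLinearGroup.toGL a : GL (Fin 3) F) *
          (((SpecialLinearGroup.toGL a)⁻¹ * SpecialLinearGroup.toGL b : GL (Fin 3) F) :
            Matrix (Fin 3) (Fin 3) F) := by
      rw [← Units.val_mul, mul_inv_cancel_left]
    rw [← hc] at h1
    rw [smul_eq_mul_diagonal]
    exact h1
  refine ⟨c, ?_, hb⟩
  have := congrArg det hb
  simpa [det_smul] using this.symm

/-- The natural map from `SL₃(F)` to `PGL₃(F)`. -/
def slToPGL (F : Type*) [Field F] : SpecialLinearGroup (Fin 3) F →* PGL3 F :=
  (QuotientGroup.mk' (Subgroup.center (GeneralLinearGroup (Fin 3) F))).comp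
    SpecialLinearGroup.toGL

theorem exists_smul_of_slToPGL_eq {a b : SpecialLinearGroup (Fin 3) F}
    (h : slToPGL F a = slToPGL F b) :
    ∃ c : F, c ^ 3 = 1 ∧ (b : Matrix (Fin 3) (Fin 3) F) = c • (a : Matrix (Fin 3) (Fin 3) F) :=
  mk_eq_mk_iff_exists_smul h

theorem eq_of_eq_smul {a b : SpecialLinearGroup (Fin 3) F} {c : F} (hc : c ^ 3 = 1)
    (h : (b : Matrix (Fin 3) (Fin 3) F) = c • (a : Matrix (Fin 3) (Fin 3) F))
    (hc2 : c ^ 2 = 1) : b = a := by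
  have : c = 1 := by linear_combination hc - c * hc2
  exact Subtype.ext (by rw [h, this, one_smul])

theorem sq_eq_one_of_smul_one {c : F}
    (h : (1 : Matrix (Fin 3) (Fin 3) F) = (c * c) • (1 : Matrix (Fin 3) (Fin 3) F)) :
    c ^ 2 = 1 := by
  have := congrFun (congrFun h 0) 0
  simp only [Matrix.smul_apply, Matrix.one_apply_eq, smul_eq_mul, mul_one] at this
  rw [sq, ← this]

theorem isInvolIso_slToPGL : IsInvolIso (slToPGL F) where
  inj x y hx hy h := by
    obtain ⟨c, hc, e⟩ := exists_smul_of_slToPGL_eq h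
    refine (eq_of_eq_smul hc e (sq_eq_one_of_smul_one ?_)).symm
    rw [sl_mul_eq_one_iff] at hx hy
    rw [← hx, ← smul_mul_smul_comm, ← e, hy, hx]
  comm x y hx hy h := by
    rw [← map_mul, ← map_mul] at h
    obtain ⟨c, hc, e⟩ := exists_smul_of_slToPGL_eq h
    refine (eq_of_eq_smul hc e (sq_eq_one_of_smul_one ?_)).symm
    have h1 : (x * (y * x)) * (x * (y * x)) = 1 := by
      calc (x * (y * x)) * (x * (y * x)) = x * (y * (x * x) * y) * x := by group
        _ = 1 := by rw [hx, mul_one, hy, mul_one, hx]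
    have h2 : ((x * (y * x) : SpecialLinearGroup (Fin 3) F) : Matrix (Fin 3) (Fin 3) F) =
        c • (y : Matrix (Fin 3) (Fin 3) F) := by
      rw [sl_mul_eq_one_iff] at hx
      change (x : Matrix (Fin 3) (Fin 3) F) * (y * x : SpecialLinearGroup (Fin 3) F) = _
      rw [e, mul_smul_comm]
      change c • ((x : Matrix (Fin 3) (Fin 3) F) * (x * y)) = _
      rw [← mul_assoc, hx, one_mul]
    rw [sl_mul_eq_one_iff] at h1 hy
    rw [← hy, ← smul_mul_smul_comm, ← h2, h1, hy]
  surj y hy := by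
    obtain ⟨g, rfl⟩ := QuotientGroup.mk_surjective y
    rw [← QuotientGroup.mk_mul, QuotientGroup.eq_one_iff,
      GeneralLinearGroup.mem_center_iff_val_mem_range_scalar] at hy
    obtain ⟨c, hc⟩ := hy
    have hcc : (g : Matrix (Fin 3) (Fin 3) F) * g = c • 1 := by
      rw [← Units.val_mul, ← hc, smul_one_eq_diagonal]; rfl
    have hdet : (g : Matrix (Fin 3) (Fin 3) F).det ^ 2 = c ^ 3 := by
      have := congrArg det hcc
      simpa [det_smul, sq] using this
    have hd0 : (g : Matrix (Fin 3) (Fin 3) F).det ≠ 0 :=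
      ((Matrix.isUnit_iff_isUnit_det _).mp g.isUnit).ne_zero
    set d := (g : Matrix (Fin 3) (Fin 3) F).det with hd
    have hc0 : c ≠ 0 := by
      rintro rfl
      exact hd0 (by simpa using hdet)
    let u : F := c / d
    have hu3 : u ^ 3 * d = 1 := by
      simp only [u]; field_simp; rw [hdet]
    have hu2 : u * u * c = 1 := by
      simp only [u]; field_simp; rw [hdet]
    let x : SpecialLinearGroup (Fin 3) F :=
      ⟨u • (g : Matrix (Fin 3) (Fin 3) F), by simpa [det_smul] using hu3⟩
    refine ⟨x, ?_, ?_⟩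
    · rw [sl_mul_eq_one_iff]
      change (u • (g : Matrix (Fin 3) (Fin 3) F)) * (u • (g : Matrix (Fin 3) (Fin 3) F)) = 1
      rw [smul_mul_smul_comm, hcc, smul_smul, hu2, one_smul]
    · symm
      change (QuotientGroup.mk g : PGL3 F) = QuotientGroup.mk (SpecialLinearGroup.toGL x)
      rw [QuotientGroup.eq, GeneralLinearGroup.mem_center_iff_val_mem_range_scalar]
      refine ⟨u, ?_⟩
      rw [Units.val_mul]
      change _ = _ * (u • (g : Matrix (Fin 3) (Fin 3) F))
      rw [mul_smul_comm, Units.inv_mul, smul_one_eq_diagonal]; rfl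

theorem isInvolIso_slToPSL :
    IsInvolIso ((slToPGL F).rangeRestrict : SpecialLinearGroup (Fin 3) F →* PSL3 F) where
  inj x y hx hy h := isInvolIso_slToPGL.inj x y hx hy (congrArg Subtype.val h)
  comm x y hx hy h := isInvolIso_slToPGL.comm x y hx hy (congrArg Subtype.val h)
  surj y hy := by
    obtain ⟨x, hx, h⟩ := isInvolIso_slToPGL.surj y.1 (congrArg Subtype.val hy)
    exact ⟨x, hx, Subtype.ext h⟩

end Projective

theorem Nat.card_eq_mul_of_torsor {α β H : Type*} (f : α → β) (act : H → α → α)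
    (hsurj : Function.Surjective f) (hinj : ∀ a, Function.Injective fun h => act h a)
    (hfib : ∀ a b, f a = f b ↔ ∃ h, act h a = b) :
    Nat.card α = Nat.card β * Nat.card H := by
  rw [← Nat.card_prod]
  symm
  choose s hs using hsurj
  refine Nat.card_congr (Equiv.ofBijective (fun p : β × H => act p.2 (s p.1)) ⟨?_, ?_⟩)
  · rintro ⟨b, h⟩ ⟨b', h'⟩ e
    have e' : act h (s b) = act h' (s b') := e
    have h1 : f (s b) = f (act h (s b)) := (hfib _ _).mpr ⟨h, rfl⟩
    have h2 : f (s b') = f (act h' (s b')) := (hfib _ _).mpr ⟨h', rfl⟩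
    obtain rfl : b = b' := by rw [← hs b, ← hs b', h1, h2, e']
    rw [hinj _ e']
  · intro a
    obtain ⟨h, hh⟩ := (hfib (s (f a)) a).mp (hs _)
    exact ⟨(f a, h), hh⟩

section Matrices

open Matrix

variable {F : Type*} [Field F]

theorem adjugate_fin_three_eq (A : Matrix (Fin 3) (Fin 3) F) :
    adjugate A = A * A - trace A • A + trace (adjugate A) • 1 := by
  rw [adjugate_fin_three]
  ext i j
  fin_cases i <;> fin_cases j <;>
    simp [mul_apply, Fin.sum_univ_three, trace_fin_three] <;> ring

theorem two_mul_trace_adjugate (A : Matrix (Fin 3) (Fin 3) F) :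
    2 * trace (adjugate A) = trace A ^ 2 - trace (A * A) := by
  rw [adjugate_fin_three]
  simp [mul_apply, Fin.sum_univ_three, trace_fin_three]
  ring

theorem mul_eq_mul_of_adjugate_eq_zero {A : Matrix (Fin 3) (Fin 3) F} (h : adjugate A = 0)
    (i j k l : Fin 3) : A k l * A i j = A k j * A i l := by
  rw [adjugate_fin_three] at h
  have h' := fun a b => congrFun (congrFun h a) b
  simp only [Fin.forall_fin_succ] at h'
  simp at h'
  obtain ⟨⟨h1, h2, h3⟩, ⟨h4, h5, h6⟩, h7, h8, h9⟩ := h'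
  by_cases hik : i = k
  · rw [hik, mul_comm]
  by_cases hjl : j = l
  · rw [hjl]
  fin_cases i <;> fin_cases k <;> first | exact absurd rfl hik | skip
  all_goals fin_cases j <;> fin_cases l <;> first | exact absurd rfl hjl | (simp; grind)

theorem trace_eq_neg_one {x : Matrix (Fin 3) (Fin 3) F} (hx : x * x = 1) (hd : det x = 1)
    (h1 : x ≠ 1) : trace x = -1 := by
  have ha : adjugate x = x := by
    calc adjugate x = adjugate x * (x * x) := by rw [hx, mul_one]
      _ = x := by rw [← mul_assoc, adjugate_mul, hd, one_smul, one_mul]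
  have h := adjugate_fin_three_eq x
  rw [ha, hx] at h
  have h' : (1 + trace x) • (x - 1) = 0 := by
    rw [add_smul, one_smul, smul_sub]
    nth_rewrite 1 [h]
    abel
  rcases smul_eq_zero.mp h' with h | h
  · linear_combination h
  · exact absurd (sub_eq_zero.mp h) h1

/-- The projection onto the fixed space of the involution `x`, along its negated space. -/
noncomputable def fixedProj (x : Matrix (Fin 3) (Fin 3) F) : Matrix (Fin 3) (Fin 3) F :=
  (2⁻¹ : F) • (1 + x)

theorem eq_two_smul_fixedProj_sub (h2 : (2 : F) ≠ 0) (x : Matrix (Fin 3) (Fin 3) F) :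
    x = (2 : F) • fixedProj x - 1 := by
  rw [fixedProj, smul_smul, mul_inv_cancel₀ h2, one_smul]
  abel

theorem exists_fixedProj_eq_vecMulVec (h2 : (2 : F) ≠ 0) {x : Matrix (Fin 3) (Fin 3) F}
    (hx : x * x = 1) (hd : det x = 1) (h1 : x ≠ 1) :
    ∃ v w : Fin 3 → F, w ⬝ᵥ v = 1 ∧ fixedProj x = vecMulVec v w := by
  have ht := trace_eq_neg_one hx hd h1
  have htA : trace (1 + x) = 2 := by
    rw [trace_add, ht, trace_one, Fintype.card_fin]
    push_cast
    ring
  have hAA : (1 + x) * (1 + x) = (2 : F) • (1 + x) := by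
    rw [add_mul, mul_add, mul_add, hx, two_smul]
    simp only [one_mul, mul_one]
    abel
  have hta : trace (adjugate (1 + x)) = 0 := by
    have := two_mul_trace_adjugate (1 + x)
    rw [hAA, trace_smul, htA, smul_eq_mul] at this
    refine (mul_eq_zero.mp (?_ : (2 : F) * _ = 0)).resolve_left h2
    rw [this]
    ring
  have hadj : adjugate (1 + x) = 0 := by
    rw [adjugate_fin_three_eq, hta, htA, hAA, sub_self, zero_smul, add_zero]
  have hne : 1 + x ≠ 0 := by
    intro h
    have := htA
    rw [h, trace_zero] at this
    exact h2 this.symm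
  obtain ⟨i, j, hij⟩ : ∃ i j, (1 + x) i j ≠ 0 := by
    by_contra! h
    exact hne (Matrix.ext h)
  set A := 1 + x with hA
  have hvw : fixedProj x = vecMulVec (fun k => A k j) (fun l => A i l / (2 * A i j)) := by
    ext k l
    rw [fixedProj, ← hA, Matrix.smul_apply, vecMulVec_apply, smul_eq_mul]
    have := mul_eq_mul_of_adjugate_eq_zero hadj i j k l
    field_simp
    exact this
  refine ⟨_, _, ?_, hvw⟩
  rw [dotProduct_comm, ← trace_vecMulVec, ← hvw, fixedProj, trace_smul, htA, smul_eq_mul,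
    inv_mul_cancel₀ h2]

theorem vecMulVec_mul_eq_zero {v w v' w' : Fin 3 → F} (h : w ⬝ᵥ v = 1) (h' : w' ⬝ᵥ v' = 1)
    (hc : vecMulVec v w * vecMulVec v' w' = vecMulVec v' w' * vecMulVec v w)
    (hne : vecMulVec v w ≠ vecMulVec v' w') : vecMulVec v w * vecMulVec v' w' = 0 := by
  have key : ∀ a b c d : Fin 3 → F, b ⬝ᵥ a = 1 →
      vecMulVec a b * vecMulVec c d = vecMulVec c d * vecMulVec a b →
      vecMulVec a b * vecMulVec c d = ((b ⬝ᵥ c) * (d ⬝ᵥ a)) • vecMulVec a b := by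
    intro a b c d hab hcomm
    calc vecMulVec a b * vecMulVec c d
        = vecMulVec a b * vecMulVec a b * vecMulVec c d := by
          rw [vecMulVec_mul_vecMulVec a b a b, hab, one_smul]
      _ = vecMulVec a b * vecMulVec c d * vecMulVec a b := by
          rw [mul_assoc, mul_assoc, ← hcomm]
      _ = _ := by
          rw [vecMulVec_mul_vecMulVec, vecMulVec_mul_vecMulVec]
          ext i j
          simp [vecMulVec_apply, smul_dotProduct]
          ring
  have e1 := key v w v' w' h hc
  have e2 := key v' w' v w h' hc.symm
  rw [← hc, e1, mul_comm] at e2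
  by_cases h0 : (w' ⬝ᵥ v) * (w ⬝ᵥ v') = 0
  · rw [e1, mul_comm, h0, zero_smul]
  · exact absurd (smul_right_injective _ h0 e2) hne

/-- `SL(3,F)`. -/
abbrev SL3 (F : Type*) [Field F] := SpecialLinearGroup (Fin 3) F

theorem IsInvol.exists_vecMulVec (h2 : (2 : F) ≠ 0) {x : SL3 F} (hx : IsInvol x) :
    ∃ v w : Fin 3 → F, w ⬝ᵥ v = 1 ∧ fixedProj x.1 = vecMulVec v w :=
  exists_fixedProj_eq_vecMulVec h2 (sl_mul_eq_one_iff.mp hx.1) x.2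
    fun h => hx.2 (Subtype.ext h)

theorem IsCommPair.fixedProj_mul (h2 : (2 : F) ≠ 0) {x y : SL3 F} (h : IsCommPair x y) :
    fixedProj x.1 * fixedProj y.1 = 0 := by
  obtain ⟨v, w, hvw, e⟩ := h.1.exists_vecMulVec h2
  obtain ⟨v', w', hvw', e'⟩ := h.2.1.exists_vecMulVec h2
  rw [e, e']
  refine vecMulVec_mul_eq_zero hvw hvw' ?_ ?_
  · rw [← e, ← e']
    have : x.1 * y.1 = y.1 * x.1 := congrArg Subtype.val h.2.2.2
    simp only [fixedProj, smul_mul_smul_comm, add_mul, mul_add, this, one_mul, mul_one]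
    congr 1
    abel
  · rw [← e, ← e']
    intro hh
    refine h.2.2.1 (Subtype.ext ?_)
    rw [eq_two_smul_fixedProj_sub h2 x.1, hh, ← eq_two_smul_fixedProj_sub h2 y.1]

theorem IsCommPair.fixedProj_coe_mul (h2 : (2 : F) ≠ 0) {x y : SL3 F} (h : IsCommPair x y) :
    fixedProj (x * y : SL3 F).1 = 1 - fixedProj x.1 - fixedProj y.1 := by
  have h0 := h.fixedProj_mul h2
  have : (x * y : SL3 F).1 = 1 - (2 : F) • fixedProj x.1 - (2 : F) • fixedProj y.1 := by
    calc x.1 * y.1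
        = ((2 : F) • fixedProj x.1 - 1) * ((2 : F) • fixedProj y.1 - 1) := by
          rw [← eq_two_smul_fixedProj_sub h2, ← eq_two_smul_fixedProj_sub h2]
      _ = _ := by
          rw [sub_mul, mul_sub, smul_mul_smul_comm, h0, smul_zero, mul_one, one_mul]
          abel
  rw [fixedProj, this]
  have e : (1 : Matrix (Fin 3) (Fin 3) F) +
      (1 - (2 : F) • fixedProj x.1 - (2 : F) • fixedProj y.1) =
      (2 : F) • (1 - fixedProj x.1 - fixedProj y.1) := by
    rw [smul_sub, smul_sub, two_smul F (1 : Matrix (Fin 3) (Fin 3) F)]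
    abel
  rw [e, smul_smul, inv_mul_cancel₀ h2, one_smul]

theorem twoRankLETwo_SL3 (h2 : (2 : F) ≠ 0) : TwoRankLETwo (SL3 F) := by
  intro x y z hxy hxz hyz
  by_contra hne
  have hz : IsCommPair z (x * y) := by
    refine ⟨hxz.2.1, hxy.right_mul.2.1, hne, ?_⟩
    rw [← mul_assoc, ← hxz.2.2.2, mul_assoc, ← hyz.2.2.2, mul_assoc]
  have h := hz.fixedProj_mul h2
  rw [hxy.fixedProj_coe_mul h2, mul_sub, mul_sub, hxz.symm.fixedProj_mul h2,
    hyz.symm.fixedProj_mul h2, mul_one, sub_zero, sub_zero] at h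
  obtain ⟨v, w, hvw, e⟩ := hxz.2.1.exists_vecMulVec h2
  rw [e] at h
  have := trace_vecMulVec v w
  rw [h, trace_zero, dotProduct_comm, hvw] at this
  exact zero_ne_one this

end Matrices

section Counting

open Matrix

variable {F : Type*} [Field F]

theorem SL3.ext_fixedProj (h2 : (2 : F) ≠ 0) {x y : SL3 F}
    (h : fixedProj x.1 = fixedProj y.1) : x = y := by
  refine Subtype.ext ?_
  rw [eq_two_smul_fixedProj_sub h2 x.1, h, ← eq_two_smul_fixedProj_sub h2 y.1]

/-- The involution with fixed line spanned by `v` and negated plane the kernel of `w`. -/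
def reflectionSL (v w : Fin 3 → F) (h : w ⬝ᵥ v = 1) : SL3 F :=
  ⟨(2 : F) • vecMulVec v w - 1, by
    rw [dotProduct, Fin.sum_univ_three] at h
    rw [det_fin_three]
    simp [vecMulVec_apply]
    linear_combination 2 * h⟩

theorem fixedProj_reflectionSL (h2 : (2 : F) ≠ 0) {v w : Fin 3 → F} (h : w ⬝ᵥ v = 1) :
    fixedProj (reflectionSL v w h).1 = vecMulVec v w := by
  rw [fixedProj, reflectionSL, add_sub_cancel, smul_smul, inv_mul_cancel₀ h2, one_smul]

theorem isInvol_reflectionSL (h2 : (2 : F) ≠ 0) {v w : Fin 3 → F} (h : w ⬝ᵥ v = 1) :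
    IsInvol (reflectionSL v w h) := by
  constructor
  · rw [sl_mul_eq_one_iff, reflectionSL]
    have : vecMulVec v w * vecMulVec v w = vecMulVec v w := by
      rw [vecMulVec_mul_vecMulVec, h, one_smul]
    rw [sub_mul, mul_sub, smul_mul_smul_comm, this, mul_smul, two_smul F ((2 : F) • _)]
    simp
  · intro e
    have h1 := fixedProj_reflectionSL h2 h
    rw [e] at h1
    have h3 := congrArg trace h1
    have h4 : fixedProj (1 : SL3 F).1 = (1 : Matrix (Fin 3) (Fin 3) F) := by
      change (2⁻¹ : F) • ((1 : Matrix (Fin 3) (Fin 3) F) + 1) = 1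
      rw [← two_smul F (1 : Matrix (Fin 3) (Fin 3) F), smul_smul, inv_mul_cancel₀ h2, one_smul]
    rw [h4, trace_vecMulVec, dotProduct_comm, h, trace_one, Fintype.card_fin] at h3
    refine h2 ?_
    push_cast at h3
    linear_combination h3

theorem vecMulVec_eq_iff {v w v' w' : Fin 3 → F} (h' : w' ⬝ᵥ v' = 1) :
    vecMulVec v w = vecMulVec v' w' ↔ ∃ u : Fˣ, (u : F) • v = v' ∧ (u⁻¹ : Fˣ) • w = w' := by
  constructor
  · intro e
    have e1 : (w ⬝ᵥ v') • v = v' := by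
      have := congrArg (· *ᵥ v') e
      simp only [vecMulVec_mulVec, h'] at this
      simpa using this
    have e2 : (w' ⬝ᵥ v) • w = w' := by
      have := congrArg (w' ᵥ* ·) e
      simp only [vecMul_vecMulVec, h'] at this
      simpa using this
    have hm : (w ⬝ᵥ v') * (w' ⬝ᵥ v) = 1 := by
      calc (w ⬝ᵥ v') * (w' ⬝ᵥ v) = w' ⬝ᵥ ((w ⬝ᵥ v') • v) := by
            rw [dotProduct_smul, smul_eq_mul]
        _ = 1 := by rw [e1, h']
    refine ⟨⟨w ⬝ᵥ v', w' ⬝ᵥ v, hm, by rw [mul_comm, hm]⟩, e1, e2⟩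
  · rintro ⟨u, rfl, rfl⟩
    ext i j
    simp only [vecMulVec_apply, Pi.smul_apply, Units.smul_def, smul_eq_mul]
    have : (u : F) * (u⁻¹ : Fˣ) = 1 := u.mul_inv
    linear_combination (-(v i * w j)) * this

/-- Pairs of a vector and a linear form taking the value `1` on it. -/
abbrev DualPair (F : Type*) [Field F] :=
  {p : (Fin 3 → F) × (Fin 3 → F) // p.2 ⬝ᵥ p.1 = 1}

theorem card_dualPair_eq (h2 : (2 : F) ≠ 0) :
    Nat.card (DualPair F) = Nat.card {x : SL3 F // IsInvol x} * Nat.card Fˣ := by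
  refine Nat.card_eq_mul_of_torsor
    (fun p => ⟨reflectionSL p.1.1 p.1.2 p.2, isInvol_reflectionSL h2 p.2⟩)
    (fun u p => ⟨((u : F) • p.1.1, (u⁻¹ : Fˣ) • p.1.2), ?_⟩) ?_ ?_ ?_
  · rw [Units.smul_def, smul_dotProduct, dotProduct_smul, p.2]
    simp
  · rintro ⟨x, hx⟩
    obtain ⟨v, w, h, e⟩ := hx.exists_vecMulVec h2
    refine ⟨⟨(v, w), h⟩, Subtype.ext (SL3.ext_fixedProj h2 ?_)⟩
    rw [e]
    exact fixedProj_reflectionSL h2 h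
  · rintro ⟨⟨v, w⟩, h⟩ u u' e
    have e' : (u : F) • v = (u' : F) • v := congrArg (fun p => p.1.1) e
    have hv : v ≠ 0 := by
      rintro rfl
      simp at h
    exact Units.ext (smul_left_injective F hv e')
  · rintro ⟨⟨v, w⟩, h⟩ ⟨⟨v', w'⟩, h'⟩
    rw [Subtype.mk.injEq]
    have : reflectionSL v w h = reflectionSL v' w' h' ↔ vecMulVec v w = vecMulVec v' w' := by
      rw [← fixedProj_reflectionSL h2 h, ← fixedProj_reflectionSL h2 h']
      exact ⟨fun e => by rw [e], SL3.ext_fixedProj h2⟩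
    simp only
    rw [this, vecMulVec_eq_iff h']
    simp [Subtype.ext_iff, Prod.ext_iff]

theorem card_dotProduct_eq_one [Fintype F] [DecidableEq F] {v : Fin 3 → F} (hv : v ≠ 0) :
    Nat.card {w : Fin 3 → F // w ⬝ᵥ v = 1} = Fintype.card F ^ 2 := by
  let f : (Fin 3 → F) →+ F :=
    { toFun := fun w => w ⬝ᵥ v
      map_zero' := zero_dotProduct v
      map_add' := fun a b => add_dotProduct a b v }
  obtain ⟨i, hi⟩ := Function.ne_iff.mp hv
  have hsurj : ∀ c, c ∈ Set.range f := fun c => by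
    refine ⟨Pi.single i (c / v i), ?_⟩
    change Pi.single i (c / v i) ⬝ᵥ v = c
    rw [single_dotProduct, div_mul_cancel₀ _ hi]
  have hcard : Fintype.card (Fin 3 → F) =
      Fintype.card F * (Finset.univ.filter fun w => f w = 1).card := by
    rw [← Finset.card_univ,
      Finset.card_eq_sum_card_fiberwise (f := f) (t := Finset.univ) (by simp [Set.MapsTo]),
      Finset.sum_const_nat (m := (Finset.univ.filter fun w => f w = 1).card), Finset.card_univ]
    intro c _
    exact AddMonoidHom.card_fiber_eq_of_mem_range f (hsurj c) (hsurj 1)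
  rw [Fintype.card_fun, Fintype.card_fin, pow_succ'] at hcard
  rw [Nat.eq_of_mul_eq_mul_left Fintype.card_pos hcard]
  exact Nat.subtype_card _ (by simp [f])

theorem card_dualPair [Fintype F] :
    Nat.card (DualPair F) = (Fintype.card F ^ 3 - 1) * Fintype.card F ^ 2 := by
  classical
  have e : DualPair F ≃ Σ v : {v : Fin 3 → F // v ≠ 0}, {w : Fin 3 → F // w ⬝ᵥ v.1 = 1} :=
    { toFun := fun p => ⟨⟨p.1.1, fun h => by simpa [h] using p.2⟩, ⟨p.1.2, p.2⟩⟩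
      invFun := fun s => ⟨(s.1.1, s.2.1), s.2.2⟩
      left_inv := fun _ => rfl
      right_inv := fun _ => rfl }
  rw [Nat.card_congr e, Nat.card_sigma, Finset.sum_congr rfl fun v _ => card_dotProduct_eq_one v.2,
    Finset.sum_const, smul_eq_mul, Finset.card_univ]
  congr 1
  rw [Fintype.card_subtype_compl, Fintype.card_subtype_eq, Fintype.card_fun, Fintype.card_fin]

/-- Conjugation by an element of `GL₃(F)`. -/
def conjSL (V : GL (Fin 3) F) (x : SL3 F) : SL3 F :=
  ⟨V.1 * x.1 * V⁻¹.1, by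
    rw [det_mul_right_comm, ← Units.val_mul, mul_inv_cancel, Units.val_one, one_mul, x.2]⟩

theorem conjSL_injective (V : GL (Fin 3) F) : Function.Injective (conjSL V) := by
  intro x y h
  have h' : V.1 * x.1 * V⁻¹.1 = V.1 * y.1 * V⁻¹.1 := congrArg Subtype.val h
  exact Subtype.ext (V.isUnit.mul_right_injective (V⁻¹.isUnit.mul_left_injective h'))

theorem conjSL_mul (V : GL (Fin 3) F) (x y : SL3 F) :
    conjSL V (x * y) = conjSL V x * conjSL V y := by
  apply Subtype.ext
  change V.1 * (x.1 * y.1) * V⁻¹.1 = V.1 * x.1 * V⁻¹.1 * (V.1 * y.1 * V⁻¹.1)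
  have : V⁻¹.1 * V.1 = 1 := V.inv_mul
  simp only [mul_assoc]
  rw [← mul_assoc V⁻¹.1 V.1, this, one_mul]

theorem conjSL_one (V : GL (Fin 3) F) : conjSL V 1 = 1 := by
  have := conjSL_mul V 1 1
  rw [one_mul] at this
  exact mul_eq_left.mp this.symm

theorem IsCommPair.conjSL {x y : SL3 F} (h : IsCommPair x y) (V : GL (Fin 3) F) :
    IsCommPair (conjSL V x) (conjSL V y) := by
  have hne : ∀ {z : SL3 F}, z ≠ 1 → _root_.conjSL V z ≠ 1 := fun hz e =>
    hz (conjSL_injective V (e.trans (conjSL_one V).symm))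
  refine ⟨⟨?_, hne h.1.2⟩, ⟨?_, hne h.2.1.2⟩, fun e => h.2.2.1 (conjSL_injective V e), ?_⟩
  · rw [← conjSL_mul, h.1.1, conjSL_one]
  · rw [← conjSL_mul, h.2.1.1, conjSL_one]
  · rw [← conjSL_mul, h.2.2.2, conjSL_mul]

/-- The diagonal involution fixing the first basis vector. -/
def diagInvolFst (F : Type*) [Field F] : SL3 F :=
  ⟨diagonal ![1, -1, -1], by simp [det_diagonal, Fin.prod_univ_three]⟩

/-- The diagonal involution fixing the second basis vector. -/
def diagInvolSnd (F : Type*) [Field F] : SL3 F :=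
  ⟨diagonal ![-1, 1, -1], by simp [det_diagonal, Fin.prod_univ_three]⟩

theorem isCommPair_diagInvol (h2 : (2 : F) ≠ 0) :
    IsCommPair (diagInvolFst F) (diagInvolSnd F) := by
  have hne : (1 : F) ≠ -1 := fun h => h2 (by linear_combination h)
  refine ⟨⟨?_, ?_⟩, ⟨?_, ?_⟩, ?_, ?_⟩
  · rw [sl_mul_eq_one_iff, diagInvolFst, diagonal_mul_diagonal, ← diagonal_one]
    congr 1
    ext i
    fin_cases i <;> simp
  · intro h
    have : (diagInvolFst F).1 1 1 = (1 : Matrix (Fin 3) (Fin 3) F) 1 1 := by rw [h]; rfl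
    exact hne (by simpa [diagInvolFst] using this.symm)
  · rw [sl_mul_eq_one_iff, diagInvolSnd, diagonal_mul_diagonal, ← diagonal_one]
    congr 1
    ext i
    fin_cases i <;> simp
  · intro h
    have : (diagInvolSnd F).1 0 0 = (1 : Matrix (Fin 3) (Fin 3) F) 0 0 := by rw [h]; rfl
    exact hne (by simpa [diagInvolSnd] using this.symm)
  · intro h
    have : (diagInvolFst F).1 0 0 = (diagInvolSnd F).1 0 0 := by rw [h]
    exact hne (by simpa [diagInvolFst, diagInvolSnd] using this)
  · apply Subtype.ext
    change (diagInvolFst F).1 * (diagInvolSnd F).1 = (diagInvolSnd F).1 * (diagInvolFst F).1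
    rw [diagInvolFst, diagInvolSnd]
    exact (commute_diagonal _ _).eq

/-- The diagonal matrix with given unit entries. -/
def diagGL (u : Fin 3 → Fˣ) : GL (Fin 3) F where
  val := diagonal fun i => (u i : F)
  inv := diagonal fun i => ((u i)⁻¹ : Fˣ)
  val_inv := by simp [diagonal_mul_diagonal]
  inv_val := by simp [diagonal_mul_diagonal]

theorem conjSL_mul_left (V W : GL (Fin 3) F) (x : SL3 F) :
    conjSL (V * W) x = conjSL V (conjSL W x) := by
  apply Subtype.ext
  change (V * W).1 * x.1 * (V * W)⁻¹.1 = V.1 * (W.1 * x.1 * W⁻¹.1) * V⁻¹.1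
  rw [_root_.mul_inv_rev, Units.val_mul, Units.val_mul]
  simp only [mul_assoc]

theorem conjSL_eq_self_iff (V : GL (Fin 3) F) (x : SL3 F) :
    conjSL V x = x ↔ V.1 * x.1 = x.1 * V.1 := by
  refine Subtype.ext_iff.trans ?_
  change V.1 * x.1 * V⁻¹.1 = x.1 ↔ _
  constructor
  · intro h
    have := congrArg (· * V.1) h
    simpa [mul_assoc] using this
  · intro h
    rw [h, mul_assoc, ← Units.val_mul, mul_inv_cancel, Units.val_one, mul_one]

theorem conjSL_diagInvol_eq_iff (h2 : (2 : F) ≠ 0) (V : GL (Fin 3) F) :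
    (conjSL V (diagInvolFst F) = diagInvolFst F ∧ conjSL V (diagInvolSnd F) = diagInvolSnd F) ↔
      ∃ u, V = diagGL u := by
  rw [conjSL_eq_self_iff, conjSL_eq_self_iff]
  constructor
  · rintro ⟨ha, hb⟩
    have hz : ∀ a : F, a = -a → a = 0 := fun a h =>
      (mul_eq_zero.mp (by linear_combination h : (2 : F) * a = 0)).resolve_left h2
    have ha' := fun i j => congrFun (congrFun ha i) j
    have hb' := fun i j => congrFun (congrFun hb i) j
    simp only [diagInvolFst, diagInvolSnd, mul_diagonal, diagonal_mul] at ha' hb'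
    have hoff : ∀ i j, i ≠ j → V.1 i j = 0 := by
      intro i j hij
      have h1 := ha' i j
      have h2 := hb' i j
      apply hz
      fin_cases i <;> fin_cases j <;> first | exact absurd rfl hij | (simp at h1 h2 ⊢; grind)
    have hdiag : V.1 = diagonal fun i => V.1 i i := by
      ext i j
      by_cases hij : i = j
      · subst hij; simp
      · rw [hoff i j hij, diagonal_apply_ne _ hij]
    have hu : IsUnit fun i => V.1 i i := by
      rw [← isUnit_diagonal, ← hdiag]
      exact V.isUnit
    have hu' := Pi.isUnit_iff.mp hu
    refine ⟨fun i => (hu' i).unit, Units.ext hdiag⟩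
  · rintro ⟨u, rfl⟩
    exact ⟨(commute_diagonal _ _).eq, (commute_diagonal _ _).eq⟩

theorem of_mul_diagonal_mul_of (d : Fin 3 → F) (v w : Fin 3 → Fin 3 → F) :
    (Matrix.of fun i k => v k i) * diagonal d * Matrix.of w =
      d 0 • vecMulVec (v 0) (w 0) + d 1 • vecMulVec (v 1) (w 1) +
        d 2 • vecMulVec (v 2) (w 2) := by
  ext i j
  simp [mul_apply, Fin.sum_univ_three, vecMulVec_apply, diagonal]
  ring

theorem exists_conjSL_eq (h2 : (2 : F) ≠ 0) {x y : SL3 F} (h : IsCommPair x y) :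
    ∃ V, conjSL V (diagInvolFst F) = x ∧ conjSL V (diagInvolSnd F) = y := by
  obtain ⟨v0, w0, -, e0⟩ := h.1.exists_vecMulVec h2
  obtain ⟨v1, w1, -, e1⟩ := h.2.1.exists_vecMulVec h2
  obtain ⟨v2, w2, -, e2⟩ := h.right_mul.2.1.exists_vecMulVec h2
  rw [h.fixedProj_coe_mul h2] at e2
  let A : Matrix (Fin 3) (Fin 3) F := Matrix.of fun i k => ![v0, v1, v2] k i
  let B : Matrix (Fin 3) (Fin 3) F := Matrix.of ![w0, w1, w2]
  have hd : ∀ d : Fin 3 → F, A * diagonal d * B = d 0 • fixedProj x.1 + d 1 • fixedProj y.1 +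
      d 2 • (1 - fixedProj x.1 - fixedProj y.1) := by
    intro d
    rw [e2, e0, e1, of_mul_diagonal_mul_of]
    rfl
  have hAB : A * B = 1 := by
    have := hd 1
    rw [diagonal_one' , mul_one] at this
    rw [this]
    simp
  refine ⟨⟨A, B, hAB, mul_eq_one_comm.mp hAB⟩, Subtype.ext ?_, Subtype.ext ?_⟩
  · change A * diagonal _ * B = _
    refine (hd _).trans (Eq.trans ?_ (eq_two_smul_fixedProj_sub h2 x.1).symm)
    simp [two_smul]
    abel
  · change A * diagonal _ * B = _
    refine (hd _).trans (Eq.trans ?_ (eq_two_smul_fixedProj_sub h2 y.1).symm)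
    simp [two_smul]
    abel

theorem card_GL_eq (h2 : (2 : F) ≠ 0) :
    Nat.card (GL (Fin 3) F) =
      Nat.card {p : SL3 F × SL3 F // IsCommPair p.1 p.2} * Nat.card (Fin 3 → Fˣ) := by
  refine Nat.card_eq_mul_of_torsor
    (fun V => ⟨(conjSL V (diagInvolFst F), conjSL V (diagInvolSnd F)),
      (isCommPair_diagInvol h2).conjSL V⟩)
    (fun u V => V * diagGL u) ?_ ?_ ?_
  · rintro ⟨⟨x, y⟩, h⟩
    obtain ⟨V, hx, hy⟩ := exists_conjSL_eq h2 h
    exact ⟨V, Subtype.ext (Prod.ext hx hy)⟩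
  · intro V u u' e
    have e' : diagGL u = diagGL u' := mul_left_cancel e
    have e'' := diagonal_injective (congrArg Units.val e')
    funext i
    exact Units.ext (congrFun e'' i)
  · intro V W
    rw [Subtype.mk.injEq, Prod.mk.injEq]
    obtain ⟨U, rfl⟩ : ∃ U, W = V * U := ⟨V⁻¹ * W, by group⟩
    rw [conjSL_mul_left, conjSL_mul_left, (conjSL_injective V).eq_iff,
      (conjSL_injective V).eq_iff, eq_comm, @eq_comm _ (diagInvolSnd F),
      conjSL_diagInvol_eq_iff h2]
    simp only [mul_right_inj, eq_comm]

end Counting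

theorem reducedEulerChar_of_isInvolIso {F : Type*} [Field F] [Fintype F] (h2 : (2 : F) ≠ 0)
    {G : Type*} [Group G] [Finite G] {f : SL3 F →* G} (hf : IsInvolIso f) :
    3 * reducedEulerChar 2 G =
      -(((Fintype.card F : ℤ) - 1) * ((Fintype.card F : ℤ) ^ 2 - 1) *
        ((Fintype.card F : ℤ) ^ 3 + 3 * (Fintype.card F : ℤ) ^ 2 +
          3 * (Fintype.card F : ℤ) + 3)) := by
  classical
  have := Fintype.ofFinite G
  have := Fintype.ofFinite (SL3 F)
  rw [three_mul_reducedEulerChar_two_s18 (hf.twoRankLETwo (twoRankLETwo_SL3 h2)),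
    hf.card_involSet, hf.card_commPairSet]
  have hI := card_dualPair_eq h2
  have hP := card_GL_eq h2
  rw [Nat.subtype_card (involSet (SL3 F)) fun x => mem_involSet, card_dualPair,
    Nat.card_eq_fintype_card, Fintype.card_units] at hI
  rw [Nat.subtype_card (commPairSet (SL3 F)) fun x => mem_commPairSet, Matrix.card_GL_field,
    Nat.card_fun, Nat.card_eq_fintype_card, Nat.card_eq_fintype_card, Fintype.card_units,
    Fintype.card_fin, Fin.prod_univ_three] at hP
  have hq : 2 ≤ Fintype.card F := Fintype.one_lt_card
  generalize (involSet (SL3 F)).card = I at *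
  generalize (commPairSet (SL3 F)).card = P at *
  generalize Fintype.card F = q at *
  have h1 : 1 ≤ q := by omega
  simp only [Fin.val_zero, Fin.val_one, Fin.val_two, pow_zero] at hP
  zify [h1, Nat.one_le_pow 3 q h1, Nat.pow_le_pow_right h1 (by decide : 1 ≤ 3),
    Nat.pow_le_pow_right h1 (by decide : 2 ≤ 3)] at hI hP
  have hq1 : (q : ℤ) - 1 ≠ 0 := by
    have : (2 : ℤ) ≤ q := by exact_mod_cast hq
    omega
  have hI' : (I : ℤ) = q ^ 2 * (q ^ 2 + q + 1) :=
    mul_right_cancel₀ hq1 (by linear_combination -hI)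
  have hP' : (P : ℤ) = q ^ 3 * (q + 1) * (q ^ 2 + q + 1) :=
    mul_right_cancel₀ (pow_ne_zero 3 hq1) (by linear_combination -hP)
  rw [hI', hP']
  ring

/-- For an odd prime power `q`:
`3·χ̃(A₂(PSL₃(q))) = -(q-1)(q²-1)(q³+3q²+3q+3)`, and
`χ̃(A₂(PGL₃(q))) = χ̃(A₂(PSL₃(q)))`. -/
theorem reducedEulerChar_PSL3_PGL3 (q : ℕ) (hq : IsPrimePow q) (hodd : Odd q)
    (F : Type*) [Field F] [Fintype F] (hF : Fintype.card F = q) :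
    3 * reducedEulerChar 2 (PSL3 F) =
      -(((q : ℤ) - 1) * ((q : ℤ) ^ 2 - 1) *
        ((q : ℤ) ^ 3 + 3 * (q : ℤ) ^ 2 + 3 * (q : ℤ) + 3)) ∧
    reducedEulerChar 2 (PGL3 F) = reducedEulerChar 2 (PSL3 F) := by
  subst hF
  have h2 : (2 : F) ≠ 0 := by
    refine Ring.two_ne_zero fun h => ?_
    have := FiniteField.even_card_iff_char_two.mp h
    exact Nat.not_odd_iff.mpr this hodd
  have hs := reducedEulerChar_of_isInvolIso h2 (isInvolIso_slToPSL (F := F))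
  have hg := reducedEulerChar_of_isInvolIso h2 (isInvolIso_slToPGL (F := F))
  exact ⟨hs, mul_left_cancel₀ three_ne_zero (hg.trans hs.symm)⟩
end
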